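/- arXiv:math/0212147 — 2 statements merged into one kernel-verified Lean document; each statement's English description precedes it below -/
import Mathlib

section
/- R is compatible modulo π²ℤ with the identifications defining 𝓒 (the value on each sheet being the corresponding analytic continuation), so it descends to a well-defined map R : 𝓒 → ℂ/π²ℤ; moreover R vanishes modulo π²ℤ on every lifted five-term relation and every transfer relation, and hence induces a group homomorphism R : êP(ℂ) → ℂ/π²ℤ. -/
open Complex
open scoped Classical

noncomputable section

namespace ExtendedBloch

/-- `π` as a complex number. -/
def Cpi : ℂ := (Real.pi : ℂ)

/-- Membership in `ℂ ∖ {0,1}`. -/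
def Reg (z : ℂ) : Prop := z ≠ 0 ∧ z ≠ 1

/-- The open upper half plane. -/
def UHP : Set ℂ := {z : ℂ | 0 < z.im}

/-- The 5-tuple occurring in the five term relation. -/
def ftTuple (x y : ℂ) : Fin 5 → ℂ :=
  ![x, y, y / x, (1 - x⁻¹) / (1 - y⁻¹), (1 - x) / (1 - y)]

/-- The set `FT` of five term tuples. -/
def FT : Set (Fin 5 → ℂ) :=
  {v | ∃ x y : ℂ, Reg x ∧ Reg y ∧ x ≠ y ∧ v = ftTuple x y}

/-- The subset `FT⁺` of tuples with all coordinates in the upper half plane. -/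
def FTplus : Set (Fin 5 → ℂ) := {v | v ∈ FT ∧ ∀ i, v i ∈ UHP}

/-- The point `(z; p, q)` of the cover `𝓒` of `ℂ ∖ {0,1}`, realized concretely as the pair of
branch values `(log z + pπi, -log(1-z) + qπi)` (Riemann surface model of `𝓒`). -/
def pt (z : ℂ) (p q : ℤ) : ℂ × ℂ :=
  (Complex.log z + p * (Cpi * I), -Complex.log (1 - z) + q * (Cpi * I))

/-- The cover `𝓒`, realized as the Riemann surface of all branches of
`(log z + pπi, -log(1-z) + qπi)` on `ℂ ∖ {0,1}`. -/
def Cover : Set (ℂ × ℂ) := {w | ∃ z : ℂ, Reg z ∧ ∃ p q : ℤ, w = pt z p q}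

lemma pt_mem_Cover {z : ℂ} (h : Reg z) (p q : ℤ) : pt z p q ∈ Cover :=
  ⟨z, h, p, q, rfl⟩

/-- `w ∈ 𝓒` lies over `z ∈ ℂ ∖ {0,1}`. -/
def LiesOver (w : ℂ × ℂ) (z : ℂ) : Prop := Reg z ∧ ∃ p q : ℤ, w = pt z p q

/-- The covering action of `ℤ × ℤ` on `𝓒`. -/
def covAct (v : ℤ × ℤ) (w : ℂ × ℂ) : ℂ × ℂ :=
  (w.1 + v.1 * (Cpi * I), w.2 + v.2 * (Cpi * I))

/-- The subset `V ⊂ (ℤ × ℤ)⁵`. -/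
def Vset : Set (Fin 5 → ℤ × ℤ) :=
  {v | ∃ p₀ p₁ q₀ q₁ q₂ : ℤ,
    v = ![(p₀, q₀), (p₁, q₁), (p₁ - p₀, q₂), (p₁ - p₀ + q₁ - q₀, q₂ - q₁),
          (q₁ - q₀, q₂ - q₁ - p₀)]}

/-- The preimage of `FT` in `𝓒⁵`. -/
def FTpre : Set (Fin 5 → ℂ × ℂ) := {w | ∃ v ∈ FT, ∀ i, LiesOver (w i) (v i)}

/-- A base point `((x₀;0,0),…,(x₄;0,0))` with `(x₀,…,x₄) ∈ FT⁺`. -/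
def basePt : Fin 5 → ℂ × ℂ := fun i => pt (ftTuple ((1 + I) / 4) I i) 0 0

/-- `𝓕𝓣̂₀`: the connected component of the preimage of `FT` in `𝓒⁵` containing the points
`((x₀;0,0),…,(x₄;0,0))` with `(x₀,…,x₄) ∈ FT⁺`. -/
def FThat₀ : Set (Fin 5 → ℂ × ℂ) := connectedComponentIn FTpre basePt

/-- `𝓕𝓣̂ = 𝓕𝓣̂₀ + V`. -/
def FThat : Set (Fin 5 → ℂ × ℂ) :=
  {u | ∃ w ∈ FThat₀, ∃ v ∈ Vset, u = fun i => covAct (v i) (w i)}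

abbrev CoverT : Type := ↥Cover

/-- The generator `(z; p, q)` of the free abelian group on `𝓒`. -/
def genOf (z : ℂ) (h : Reg z) (p q : ℤ) : FreeAbelianGroup CoverT :=
  FreeAbelianGroup.of ⟨pt z p q, pt_mem_Cover h p q⟩

/-- The lifted five term relators. -/
def FiveTermRels : Set (FreeAbelianGroup CoverT) :=
  {a | ∃ w : Fin 5 → ℂ × ℂ, w ∈ FThat ∧ ∃ hc : ∀ i, w i ∈ Cover,
    a = ∑ i : Fin 5, (-1 : ℤ) ^ (i : ℕ) • FreeAbelianGroup.of (⟨w i, hc i⟩ : CoverT)}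

/-- The transfer relators. -/
def TransferRels : Set (FreeAbelianGroup CoverT) :=
  {a | ∃ z : ℂ, ∃ h : Reg z, ∃ p q p' q' : ℤ,
    a = genOf z h p q + genOf z h p' q' - genOf z h p q' - genOf z h p' q}

def relSub : AddSubgroup (FreeAbelianGroup CoverT) :=
  AddSubgroup.closure (FiveTermRels ∪ TransferRels)

def relSub' : AddSubgroup (FreeAbelianGroup CoverT) :=
  AddSubgroup.closure FiveTermRels

/-- The extended pre-Bloch group `êP(ℂ)`. -/
abbrev EPreBloch : Type := FreeAbelianGroup CoverT ⧸ relSub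

/-- The variant `êP'(ℂ)` without the transfer relations. -/
abbrev EPreBloch' : Type := FreeAbelianGroup CoverT ⧸ relSub'

/-- The class `[z, p, q] ∈ êP(ℂ)` (junk value `0` if `z ∈ {0,1}`). -/
def cls (z : ℂ) (p q : ℤ) : EPreBloch :=
  if h : Reg z then QuotientAddGroup.mk (genOf z h p q) else 0

/-- The class `[z, p, q] ∈ êP'(ℂ)` (junk value `0` if `z ∈ {0,1}`). -/
def cls' (z : ℂ) (p q : ℤ) : EPreBloch' :=
  if h : Reg z then QuotientAddGroup.mk (genOf z h p q) else 0

/-- `ℂ ∧_ℤ ℂ`, the second exterior power of `ℂ` as a `ℤ`-module. -/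
abbrev L2C : Type := ↥(⋀[ℤ]^2 ℂ)

/-- The wedge `a ∧ b ∈ ℂ ∧_ℤ ℂ`. -/
def wedge (a b : ℂ) : L2C :=
  ⟨ExteriorAlgebra.ιMulti ℤ 2 ![a, b],
   ExteriorAlgebra.ιMulti_range ℤ 2 (Set.mem_range_self _)⟩

def nuFree : FreeAbelianGroup CoverT →+ L2C :=
  FreeAbelianGroup.lift fun w : CoverT => wedge w.1.1 w.1.2

/-- The homomorphism `ν : êP(ℂ) → ℂ ∧_ℤ ℂ`. -/
def nuHom : EPreBloch →+ L2C :=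
  if h : ∀ a ∈ relSub, nuFree a = 0 then QuotientAddGroup.lift relSub nuFree h else 0

/-- The homomorphism `ν : êP'(ℂ) → ℂ ∧_ℤ ℂ`. -/
def nuHom' : EPreBloch' →+ L2C :=
  if h : ∀ a ∈ relSub', nuFree a = 0 then QuotientAddGroup.lift relSub' nuFree h else 0

/-- The extended Bloch group `êB(ℂ) = ker ν`. -/
def EBloch : AddSubgroup EPreBloch := nuHom.ker

/-- `êB'(ℂ) = ker ν` on `êP'(ℂ)`. -/
def EBloch' : AddSubgroup EPreBloch' := nuHom'.ker

/-- The component `X₀₀` of `𝓒` (both fiber coordinates even). -/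
def X00 : Set (ℂ × ℂ) := {w | ∃ z : ℂ, Reg z ∧ ∃ p q : ℤ, w = pt z (2 * p) (2 * q)}

abbrev X00T : Type := ↥X00

lemma pt_mem_X00 {z : ℂ} (h : Reg z) (p q : ℤ) : pt z (2 * p) (2 * q) ∈ X00 :=
  ⟨z, h, p, q, rfl⟩

/-- The generator `(z; 2p, 2q)` of the free abelian group on `X₀₀`. -/
def genOf₀ (z : ℂ) (h : Reg z) (p q : ℤ) : FreeAbelianGroup X00T :=
  FreeAbelianGroup.of ⟨pt z (2 * p) (2 * q), pt_mem_X00 h p q⟩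

/-- The five term relators coming from `𝓕𝓣̂ ∩ (X₀₀)⁵`. -/
def FiveTermRels₀ : Set (FreeAbelianGroup X00T) :=
  {a | ∃ w : Fin 5 → ℂ × ℂ, w ∈ FThat ∧ ∃ hc : ∀ i, w i ∈ X00,
    a = ∑ i : Fin 5, (-1 : ℤ) ^ (i : ℕ) • FreeAbelianGroup.of (⟨w i, hc i⟩ : X00T)}

def relSub₀ : AddSubgroup (FreeAbelianGroup X00T) := AddSubgroup.closure FiveTermRels₀

/-- The true extended pre-Bloch group `êêP(ℂ)`. -/
abbrev EEPreBloch : Type := FreeAbelianGroup X00T ⧸ relSub₀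

/-- The class `[z, 2p, 2q] ∈ êêP(ℂ)` (junk value `0` if `z ∈ {0,1}`). -/
def cls₀ (z : ℂ) (p q : ℤ) : EEPreBloch :=
  if h : Reg z then QuotientAddGroup.mk (genOf₀ z h p q) else 0

def nuFree₀ : FreeAbelianGroup X00T →+ L2C :=
  FreeAbelianGroup.lift fun w : X00T => wedge w.1.1 w.1.2

/-- The homomorphism `ν̂ : êêP(ℂ) → ℂ ∧_ℤ ℂ`. -/
def nuHom₀ : EEPreBloch →+ L2C :=
  if h : ∀ a ∈ relSub₀, nuFree₀ a = 0 then QuotientAddGroup.lift relSub₀ nuFree₀ h else 0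

/-- The true extended Bloch group `êêB(ℂ) = ker ν̂`. -/
def EEBloch : AddSubgroup EEPreBloch := nuHom₀.ker

/-- The Rogers dilogarithm `𝓡(z) = ½ log z log(1-z) - ∫₀ᶻ log(1-t)/t dt` (straight segment,
parametrized by `t = s z`). -/
def rogers (z : ℂ) : ℂ :=
  (1 / 2) * Complex.log z * Complex.log (1 - z) -
    ∫ s in (0:ℝ)..(1:ℝ), Complex.log (1 - (s : ℂ) * z) / (s : ℂ)

/-- `R(z; p, q) = 𝓡(z) + (πi/2)(p log(1-z) + q log z) - π²/6`. -/
def Rfun (z : ℂ) (p q : ℤ) : ℂ :=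
  rogers z + (Cpi * I / 2) * (p * Complex.log (1 - z) + q * Complex.log z) - Cpi ^ 2 / 6

/-- `R̂(z; 2p, 2q) = 𝓡(z) + πi(p log(1-z) + q log z) - π²/6`. -/
def Rhat (z : ℂ) (p q : ℤ) : ℂ :=
  rogers z + Cpi * I * (p * Complex.log (1 - z) + q * Complex.log z) - Cpi ^ 2 / 6

/-- `ℂ / π²ℤ`. -/
abbrev ModPiSq : Type := ℂ ⧸ AddSubgroup.zmultiples (Cpi ^ 2)

/-- `ℂ / 2π²ℤ`. -/
abbrev Mod2PiSq : Type := ℂ ⧸ AddSubgroup.zmultiples (2 * Cpi ^ 2)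

abbrev RegT : Type := {z : ℂ // Reg z}

def pbGen (z : ℂ) (h : Reg z) : FreeAbelianGroup RegT := FreeAbelianGroup.of ⟨z, h⟩

/-- The five term relators for the classical pre-Bloch group. -/
def pbRels : Set (FreeAbelianGroup RegT) :=
  {a | ∃ x y : ℂ, ∃ hx : Reg x, ∃ hy : Reg y, x ≠ y ∧
    ∃ h2 : Reg (y / x), ∃ h3 : Reg ((1 - x⁻¹) / (1 - y⁻¹)), ∃ h4 : Reg ((1 - x) / (1 - y)),
    a = pbGen x hx - pbGen y hy + pbGen (y / x) h2 -
        pbGen ((1 - x⁻¹) / (1 - y⁻¹)) h3 + pbGen ((1 - x) / (1 - y)) h4}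

def pbSub : AddSubgroup (FreeAbelianGroup RegT) := AddSubgroup.closure pbRels

/-- The classical pre-Bloch group `P(ℂ)`. -/
abbrev PreBloch : Type := FreeAbelianGroup RegT ⧸ pbSub

/-- The class `[z] ∈ P(ℂ)` (junk value `0` if `z ∈ {0,1}`). -/
def pbCls (z : ℂ) : PreBloch :=
  if h : Reg z then QuotientAddGroup.mk (pbGen z h) else 0

/-- `ℂ* ∧_ℤ ℂ*`, the second exterior power of the multiplicative group `ℂ*` as `ℤ`-module. -/
abbrev L2CU : Type := ↥(⋀[ℤ]^2 (Additive ℂˣ))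

/-- The wedge `a ∧ b ∈ ℂ* ∧_ℤ ℂ*`. -/
def wedgeU (a b : ℂˣ) : L2CU :=
  ⟨ExteriorAlgebra.ιMulti ℤ 2 ![Additive.ofMul a, Additive.ofMul b],
   ExteriorAlgebra.ιMulti_range ℤ 2 (Set.mem_range_self _)⟩

def nuPBFree : FreeAbelianGroup RegT →+ L2CU :=
  FreeAbelianGroup.lift fun z : RegT =>
    2 • wedgeU (Units.mk0 z.1 z.2.1) (Units.mk0 (1 - z.1) (sub_ne_zero_of_ne (Ne.symm z.2.2)))

/-- The homomorphism `P(ℂ) → ℂ* ∧_ℤ ℂ*`, `[z] ↦ 2 (z ∧ (1-z))`. -/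
def nuPB : PreBloch →+ L2CU :=
  if h : ∀ a ∈ pbSub, nuPBFree a = 0 then QuotientAddGroup.lift pbSub nuPBFree h else 0

/-- The classical Bloch group `B(ℂ)`. -/
def Bloch : AddSubgroup PreBloch := nuPB.ker

/-- The roots of unity in `ℂ*`. -/
def muStar : Set ℂˣ := {ζ | ∃ n : ℕ, 0 < n ∧ ζ ^ n = 1}

abbrev SL2C := Matrix.SpecialLinearGroup (Fin 2) ℂ

/-- `PSL(2,ℂ) = SL(2,ℂ)/{±1}` as a discrete group. -/
abbrev PSL2C := SL2C ⧸ Subgroup.center SL2C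

/-- The boundary map `C₃ → C₂` of the inhomogeneous bar complex computing `H₃(PSL(2,ℂ);ℤ)`. -/
def d3 : FreeAbelianGroup (Fin 3 → PSL2C) →+ FreeAbelianGroup (Fin 2 → PSL2C) :=
  FreeAbelianGroup.lift fun g =>
    FreeAbelianGroup.of ![g 1, g 2] - FreeAbelianGroup.of ![g 0 * g 1, g 2] +
      FreeAbelianGroup.of ![g 0, g 1 * g 2] - FreeAbelianGroup.of ![g 0, g 1]

/-- The boundary map `C₄ → C₃` of the inhomogeneous bar complex computing `H₃(PSL(2,ℂ);ℤ)`. -/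
def d4 : FreeAbelianGroup (Fin 4 → PSL2C) →+ FreeAbelianGroup (Fin 3 → PSL2C) :=
  FreeAbelianGroup.lift fun g =>
    FreeAbelianGroup.of ![g 1, g 2, g 3] - FreeAbelianGroup.of ![g 0 * g 1, g 2, g 3] +
      FreeAbelianGroup.of ![g 0, g 1 * g 2, g 3] - FreeAbelianGroup.of ![g 0, g 1, g 2 * g 3] +
      FreeAbelianGroup.of ![g 0, g 1, g 2]

/-- `H₃(PSL(2,ℂ);ℤ)`, defined as homology of the inhomogeneous bar complex. -/
abbrev H3PSL2C : Type := ↥d3.ker ⧸ ((d4.range).addSubgroupOf d3.ker)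

/-- The set of combinatorial flattenings. -/
def Flattenings : Set (ℂ × ℂ × ℂ) :=
  {w | w.1 + w.2.1 + w.2.2 = 0 ∧ ∃ z : ℂ, Reg z ∧ ∃ p q r : ℤ,
    w.1 = Complex.log z + p * (Cpi * I) ∧
    w.2.1 = -Complex.log (1 - z) + q * (Cpi * I) ∧
    w.2.2 = Complex.log (1 - z) - Complex.log z + r * (Cpi * I)}

/-- The map `ℓ : 𝓒 → ℂ³`. -/
def ellMap (w : ℂ × ℂ) : ℂ × ℂ × ℂ := (w.1, w.2, -w.1 - w.2)

/-- The element `κ = [x,1,1] + [x,0,0] - [x,1,0] - [x,0,1] ∈ êP'(ℂ)`. -/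
def kap (x : ℂ) : EPreBloch' := cls' x 1 1 + cls' x 0 0 - cls' x 1 0 - cls' x 0 1

/-- The natural projection `êP'(ℂ) → êP(ℂ)`. -/
def projP : EPreBloch' →+ EPreBloch :=
  QuotientAddGroup.map relSub' relSub (AddMonoidHom.id _)
    (by
      rw [AddSubgroup.comap_id]
      exact AddSubgroup.closure_mono Set.subset_union_left)

section Helpers

open Filter Topology MeasureTheory

/-- The dilogarithm `-∫₀ᶻ log(1-t)/t dt` along the straight segment. -/
def dilog (z : ℂ) : ℂ := -∫ s in (0 : ℝ)..1, Complex.log (1 - (s : ℂ) * z) / (s : ℂ)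

lemma rogers_eq (z : ℂ) :
    rogers z = (1 / 2) * Complex.log z * Complex.log (1 - z) + dilog z := by
  rw [rogers, dilog, sub_eq_add_neg]

lemma dilog_zero : dilog 0 = 0 := by simp [dilog]

lemma norm_log_one_sub_le {z : ℂ} (hz : ‖z‖ ≤ 1 / 2) : ‖Complex.log (1 - z)‖ ≤ 3 / 2 * ‖z‖ := by
  have := norm_log_one_add_half_le_self (z := -z) (by rwa [norm_neg])
  rwa [norm_neg, ← sub_eq_add_neg] at this

lemma norm_log_le (z : ℂ) : ‖Complex.log z‖ ≤ |Real.log ‖z‖| + Real.pi := by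
  refine (Complex.norm_le_abs_re_add_abs_im _).trans ?_
  rw [Complex.log_re, Complex.log_im]
  gcongr
  exact Complex.abs_arg_le_pi z

lemma one_sub_mul_mem_slitPlane {z : ℂ} (hz : 1 - z ∈ slitPlane) {s : ℝ} (h0 : 0 ≤ s)
    (h1 : s ≤ 1) : 1 - (s : ℂ) * z ∈ slitPlane := by
  have := starConvex_one_slitPlane hz (sub_nonneg.2 h1) h0 (by ring)
  convert this using 1
  simp only [Complex.real_smul]
  push_cast
  ring

lemma measurable_log_one_sub_div (z : ℂ) :
    Measurable fun s : ℝ => Complex.log (1 - (s : ℂ) * z) / (s : ℂ) := by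
  fun_prop

/-- Near `0` the integrand is bounded, elsewhere it is controlled by the logarithm. -/
lemma norm_log_one_sub_div_le (z : ℂ) {c : ℝ} (hc : 0 < c) (hcz : c * ‖z‖ ≤ 1 / 2) {s : ℝ}
    (hs : 0 ≤ s) :
    ‖Complex.log (1 - (s : ℂ) * z) / (s : ℂ)‖ ≤
      3 / 2 * ‖z‖ + c⁻¹ * ‖Complex.log (1 - (s : ℂ) * z)‖ := by
  rcases hs.eq_or_lt with rfl | hs
  · simp
  rw [norm_div, Complex.norm_of_nonneg hs.le]
  rcases le_total s c with h | h
  · have h1 : ‖(s : ℂ) * z‖ = s * ‖z‖ := by rw [norm_mul, Complex.norm_of_nonneg hs.le]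
    have h2 := norm_log_one_sub_le (z := (s : ℂ) * z)
      (by rw [h1]; exact (mul_le_mul_of_nonneg_right h (norm_nonneg _)).trans hcz)
    rw [h1] at h2
    have h3 : ‖Complex.log (1 - (s : ℂ) * z)‖ / s ≤ 3 / 2 * ‖z‖ := by
      rw [div_le_iff₀ hs]; linarith
    have : 0 ≤ c⁻¹ * ‖Complex.log (1 - (s : ℂ) * z)‖ := by positivity
    linarith
  · have h3 : ‖Complex.log (1 - (s : ℂ) * z)‖ / s ≤ c⁻¹ * ‖Complex.log (1 - (s : ℂ) * z)‖ := by
      rw [div_eq_inv_mul]; gcongr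
    have : 0 ≤ 3 / 2 * ‖z‖ := by positivity
    linarith

lemma intervalIntegrable_of_log {z : ℂ} {b : ℝ} (hb : 0 ≤ b)
    (h : IntervalIntegrable (fun s : ℝ => Complex.log (1 - (s : ℂ) * z)) volume 0 b) :
    IntervalIntegrable (fun s : ℝ => Complex.log (1 - (s : ℂ) * z) / (s : ℂ)) volume 0 b := by
  obtain ⟨c, hc, hcz⟩ : ∃ c : ℝ, 0 < c ∧ c * ‖z‖ ≤ 1 / 2 := by
    refine ⟨(2 * (‖z‖ + 1))⁻¹, by positivity, ?_⟩
    rw [inv_mul_le_iff₀ (by positivity)]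
    linarith
  refine (((intervalIntegrable_const (c := 3 / 2 * ‖z‖)).add (h.norm.const_mul c⁻¹))).mono_fun'
    (measurable_log_one_sub_div z).aestronglyMeasurable ?_
  refine (ae_restrict_iff' measurableSet_uIoc).2 (Eventually.of_forall fun s hs => ?_)
  rw [Set.uIoc_of_le hb] at hs
  exact norm_log_one_sub_div_le z hc hcz hs.1.le

lemma intervalIntegrable_slit {z : ℂ} (hz : 1 - z ∈ slitPlane) :
    IntervalIntegrable (fun s : ℝ => Complex.log (1 - (s : ℂ) * z) / (s : ℂ)) volume 0 1 := by
  refine intervalIntegrable_of_log zero_le_one (ContinuousOn.intervalIntegrable ?_)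
  rw [Set.uIcc_of_le zero_le_one]
  refine ContinuousOn.clog (by fun_prop) fun s hs => one_sub_mul_mem_slitPlane hz hs.1 hs.2

lemma intervalIntegrable_real {b : ℝ} (hb : 0 ≤ b) :
    IntervalIntegrable (fun s : ℝ => Complex.log (1 - (s : ℂ)) / (s : ℂ)) volume 0 b := by
  have key : IntervalIntegrable (fun s : ℝ => Complex.log (1 - (s : ℂ) * 1)) volume 0 b := by
    have h1 : IntervalIntegrable (fun s : ℝ => |Real.log (1 - s)| + Real.pi) volume 0 b := by
      refine IntervalIntegrable.add ?_ intervalIntegrable_const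
      have := (intervalIntegral.intervalIntegrable_log' (a := 1 - 0) (b := 1 - b)).comp_sub_left 1
      simpa using this.abs
    have hm : Measurable fun s : ℝ => Complex.log (1 - (s : ℂ) * 1) := by fun_prop
    refine h1.mono_fun' hm.aestronglyMeasurable (Eventually.of_forall fun s => ?_)
    refine (norm_log_le _).trans ?_
    have : (1 : ℂ) - (s : ℂ) * 1 = ((1 - s : ℝ) : ℂ) := by push_cast; ring
    simp only [this, Complex.norm_real, Real.norm_eq_abs, Real.log_abs, le_refl]
  simpa using intervalIntegrable_of_log hb key

lemma hasDerivAt_log_one_sub {z : ℂ} (hz : 1 - z ∈ slitPlane) :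
    HasDerivAt (fun w => Complex.log (1 - w)) (-1 / (1 - z)) z :=
  ((hasDerivAt_id z).const_sub 1).clog hz

/-- The dilogarithm is holomorphic off the cut `[1, ∞)`. -/
lemma hasDerivAt_dilog {z : ℂ} (hz : 1 - z ∈ slitPlane) (hz0 : z ≠ 0) :
    HasDerivAt dilog (-Complex.log (1 - z) / z) z := by
  have hopen : IsOpen {w : ℂ | 1 - w ∈ slitPlane} :=
    isOpen_slitPlane.preimage (by fun_prop)
  obtain ⟨r, hr, hrU⟩ := Metric.nhds_basis_closedBall.mem_iff.1 (hopen.mem_nhds hz)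
  have hcomp : IsCompact (Set.Icc (0 : ℝ) 1 ×ˢ Metric.closedBall z r) :=
    isCompact_Icc.prod (isCompact_closedBall z r)
  have hcont : ContinuousOn (fun p : ℝ × ℂ => -(1 - (p.1 : ℂ) * p.2)⁻¹)
      (Set.Icc (0 : ℝ) 1 ×ˢ Metric.closedBall z r) := by
    refine (ContinuousOn.inv₀ (by fun_prop) ?_).neg
    rintro ⟨s, w⟩ ⟨hs, hw⟩
    exact slitPlane_ne_zero (one_sub_mul_mem_slitPlane (hrU hw) hs.1 hs.2)
  obtain ⟨C, hC⟩ := hcomp.exists_bound_of_continuousOn hcont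
  have hslice : ContinuousOn (fun s : ℝ => -(1 - (s : ℂ) * z)⁻¹) (Set.uIcc 0 1) := by
    rw [Set.uIcc_of_le zero_le_one]
    refine hcont.comp (f := fun s : ℝ => (s, z)) (by fun_prop) fun s hs => ?_
    exact ⟨hs, Metric.mem_closedBall_self hr.le⟩
  have hmain := (intervalIntegral.hasDerivAt_integral_of_dominated_loc_of_deriv_le
    (μ := volume) (a := (0 : ℝ)) (b := 1) (s := Metric.closedBall z r) (x₀ := z)
    (F := fun w s => Complex.log (1 - (s : ℂ) * w) / (s : ℂ))
    (F' := fun w s => -(1 - (s : ℂ) * w)⁻¹) (bound := fun _ => C)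
    (Metric.closedBall_mem_nhds z hr)
    (Eventually.of_forall fun w => (measurable_log_one_sub_div w).aestronglyMeasurable)
    (intervalIntegrable_slit hz)
    (by fun_prop)
    (Eventually.of_forall fun s hs w hw => by
      rw [Set.uIoc_of_le zero_le_one] at hs
      exact hC (s, w) ⟨⟨hs.1.le, hs.2⟩, hw⟩)
    intervalIntegrable_const
    (Eventually.of_forall fun s hs w hw => by
      rw [Set.uIoc_of_le zero_le_one] at hs
      have hs0 : (s : ℂ) ≠ 0 := by exact_mod_cast hs.1.ne'
      have hm := one_sub_mul_mem_slitPlane (hrU hw) hs.1.le hs.2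
      have h1 : HasDerivAt (fun w : ℂ => 1 - (s : ℂ) * w) (-(s : ℂ)) w := by
        simpa using ((hasDerivAt_id w).const_mul (s : ℂ)).const_sub 1
      refine ((h1.clog hm).div_const (s : ℂ)).congr_deriv ?_
      have := slitPlane_ne_zero hm
      field_simp)).2
  have hval : ∫ s in (0 : ℝ)..1, -(1 - (s : ℂ) * z)⁻¹ = Complex.log (1 - z) / z := by
    have hd : ∀ s ∈ Set.uIcc (0 : ℝ) 1,
        HasDerivAt (fun s : ℝ => Complex.log (1 - (s : ℂ) * z) / z) (-(1 - (s : ℂ) * z)⁻¹) s := by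
      intro s hs
      rw [Set.uIcc_of_le zero_le_one] at hs
      have hm := one_sub_mul_mem_slitPlane hz hs.1 hs.2
      have h1 : HasDerivAt (fun s : ℝ => 1 - (s : ℂ) * z) (-z) s := by
        simpa using ((hasDerivAt_id s).ofReal_comp.mul_const z).const_sub 1
      refine ((h1.clog_real hm).div_const z).congr_deriv ?_
      have := slitPlane_ne_zero hm
      field_simp
    rw [intervalIntegral.integral_eq_sub_of_hasDerivAt hd hslice.intervalIntegrable]
    simp
  rw [hval] at hmain
  have := hmain.neg
  rw [← neg_div] at this
  exact this

/-- Real integral representation of the dilogarithm. -/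
lemma dilog_ofReal {x : ℝ} (hx : 0 < x) :
    dilog x = -∫ s in (0 : ℝ)..x, Complex.log (1 - (s : ℂ)) / (s : ℂ) := by
  have h := intervalIntegral.integral_comp_mul_right (a := 0) (b := 1)
    (fun u : ℝ => Complex.log (1 - (u : ℂ)) / (u : ℂ)) hx.ne'
  rw [zero_mul, one_mul] at h
  have h2 : ∫ s in (0 : ℝ)..x, Complex.log (1 - (s : ℂ)) / (s : ℂ) =
      x • ∫ s in (0 : ℝ)..1, Complex.log (1 - ((s * x : ℝ) : ℂ)) / ((s * x : ℝ) : ℂ) := by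
    rw [h, smul_inv_smul₀ hx.ne']
  rw [dilog, h2, ← intervalIntegral.integral_smul]
  congr 1
  refine intervalIntegral.integral_congr fun s _ => ?_
  have hx' : (x : ℂ) ≠ 0 := by exact_mod_cast hx.ne'
  simp only [Complex.real_smul, Complex.ofReal_mul]
  rcases eq_or_ne (s : ℂ) 0 with h0 | h0
  · simp [h0]
  · field_simp

lemma hasDerivAt_log_one_sub_ofReal {x : ℝ} (hx : x ≠ 1) :
    HasDerivAt (fun u : ℝ => Complex.log (1 - (u : ℂ))) (-1 / (1 - (x : ℂ))) x := by
  rcases hx.lt_or_gt with h | h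
  · refine (hasDerivAt_log_one_sub (z := x) ?_).comp_ofReal
    left
    simpa using h
  · have h1 : HasDerivAt (fun u : ℝ => ((Real.log (u - 1) : ℝ) : ℂ) + Real.pi * I)
        (((1 / (x - 1) : ℝ) : ℂ)) x :=
      ((((hasDerivAt_id x).sub_const 1).log (by simpa using (sub_pos.2 h).ne')).ofReal_comp).add_const _
    have h2 : (((1 / (x - 1) : ℝ) : ℂ)) = -1 / (1 - (x : ℂ)) := by
      push_cast
      rw [← neg_sub, div_neg, neg_div]
    rw [h2] at h1
    refine h1.congr_of_eventuallyEq ?_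
    filter_upwards [lt_mem_nhds h] with u hu
    have hn : (1 - (u : ℂ)) = ((-(u - 1) : ℝ) : ℂ) := by push_cast; ring
    have hu' : 0 < u - 1 := sub_pos.2 hu
    rw [hn, Complex.log, Complex.arg_ofReal_of_neg (by linarith), Complex.norm_real,
      Real.norm_eq_abs, abs_neg, abs_of_pos hu']

lemma hasDerivAt_dilog_ofReal {x : ℝ} (hx : 0 < x) (hx1 : x ≠ 1) :
    HasDerivAt (fun u : ℝ => dilog u) (-(Complex.log (1 - (x : ℂ)) / (x : ℂ))) x := by
  have hc : ContinuousAt (fun s : ℝ => Complex.log (1 - (s : ℂ)) / (s : ℂ)) x :=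
    (hasDerivAt_log_one_sub_ofReal hx1).continuousAt.div (by fun_prop) (by exact_mod_cast hx.ne')
  have hm : Measurable fun s : ℝ => Complex.log (1 - (s : ℂ)) / (s : ℂ) := by fun_prop
  have h := (intervalIntegral.integral_hasDerivAt_right (intervalIntegrable_real hx.le)
    hm.stronglyMeasurable.stronglyMeasurableAtFilter hc).neg
  refine h.congr_of_eventuallyEq ?_
  filter_upwards [lt_mem_nhds hx] with u hu
  exact dilog_ofReal hu

lemma continuousAt_dilog_ofReal {x : ℝ} (hx : 0 < x) :
    ContinuousAt (fun u : ℝ => dilog u) x := by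
  have hcont : ContinuousOn (fun u : ℝ => ∫ s in (0 : ℝ)..u, Complex.log (1 - (s : ℂ)) / (s : ℂ))
      (Set.uIcc 0 (x + 1)) :=
    intervalIntegral.continuousOn_primitive_interval
      (by
        have := intervalIntegrable_real (b := x + 1) (by linarith)
        rwa [intervalIntegrable_iff', ] at this)
  have hmem : Set.uIcc 0 (x + 1) ∈ 𝓝 x := by
    rw [Set.uIcc_of_le (by linarith)]
    exact Icc_mem_nhds hx (by linarith)
  refine (hcont.continuousAt hmem).neg.congr ?_
  filter_upwards [lt_mem_nhds hx] with u hu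
  exact (dilog_ofReal hu).symm

lemma dilog_one : dilog 1 = (Real.pi : ℂ) ^ 2 / 6 := by
  have hF : ∀ n : ℕ, ∫ s in Set.Ioo (0 : ℝ) 1, s ^ n / ((n : ℝ) + 1) = 1 / ((n : ℝ) + 1) ^ 2 := by
    intro n
    rw [← integral_Ioc_eq_integral_Ioo, ← intervalIntegral.integral_of_le zero_le_one,
      intervalIntegral.integral_div, integral_pow]
    simp
    field_simp
  have hnonneg : ∀ n : ℕ, ∀ s ∈ Set.Ioo (0 : ℝ) 1, 0 ≤ s ^ n / ((n : ℝ) + 1) := by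
    intro n s hs
    have := hs.1
    positivity
  have hz : HasSum (fun n : ℕ => 1 / ((n : ℝ) + 1) ^ 2) (Real.pi ^ 2 / 6) := by
    have := (hasSum_nat_add_iff' 1).2 hasSum_zeta_two
    simpa using this
  have hsum := hasSum_integral_of_summable_integral_norm
    (μ := volume.restrict (Set.Ioo (0 : ℝ) 1)) (F := fun (n : ℕ) (s : ℝ) => s ^ n / ((n : ℝ) + 1))
    (fun n => by
      have : IntervalIntegrable (fun s : ℝ => s ^ n / ((n : ℝ) + 1)) volume 0 1 :=
        Continuous.intervalIntegrable (by fun_prop) _ _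
      rw [intervalIntegrable_iff_integrableOn_Ioo_of_le zero_le_one] at this
      exact this)
    (by
      refine hz.summable.congr fun n => ?_
      rw [← hF n]
      refine setIntegral_congr_fun measurableSet_Ioo fun s hs => ?_
      rw [Real.norm_of_nonneg (hnonneg n s hs)])
  simp only [hF] at hsum
  have hI := hsum.unique hz
  have hlog : ∫ s in Set.Ioo (0 : ℝ) 1, -(Real.log (1 - s) / s) = Real.pi ^ 2 / 6 := by
    rw [← hI]
    refine setIntegral_congr_fun measurableSet_Ioo fun s hs => ?_
    have h := (Real.hasSum_pow_div_log_of_abs_lt_one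
      (x := s) (by rw [abs_of_pos hs.1]; exact hs.2)).div_const s
    have hs0 := hs.1.ne'
    have h' : HasSum (fun n : ℕ => s ^ n / ((n : ℝ) + 1)) (-Real.log (1 - s) / s) := by
      refine h.congr_fun fun n => ?_
      rw [pow_succ]
      field_simp
    rw [h'.tsum_eq, neg_div]
  have hone := dilog_ofReal one_pos
  rw [Complex.ofReal_one] at hone
  rw [hone, intervalIntegral.integral_of_le zero_le_one, integral_Ioc_eq_integral_Ioo,
    ← integral_neg]
  have : (Real.pi : ℂ) ^ 2 / 6 = ((Real.pi ^ 2 / 6 : ℝ) : ℂ) := by push_cast; ring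
  rw [this, ← hlog, ← integral_complex_ofReal]
  refine setIntegral_congr_fun measurableSet_Ioo fun s hs => ?_
  have : (1 : ℂ) - s = ((1 - s : ℝ) : ℂ) := by push_cast; ring
  simp only [this]
  rw [← Complex.ofReal_log (by linarith [hs.2])]
  push_cast
  ring

lemma tendsto_dilog_zero : Tendsto dilog (𝓝 0) (𝓝 0) := by
  have hzero : Tendsto (fun z : ℂ => 3 / 2 * ‖z‖) (𝓝 0) (𝓝 0) := by
    have hc : Continuous fun z : ℂ => 3 / 2 * ‖z‖ := by fun_prop
    simpa using hc.tendsto 0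
  refine squeeze_zero_norm' ?_ hzero
  filter_upwards [Metric.ball_mem_nhds (0 : ℂ) (by norm_num : (0 : ℝ) < 1 / 2)] with z hz
  rw [mem_ball_zero_iff] at hz
  rw [dilog, norm_neg]
  refine (intervalIntegral.norm_integral_le_of_norm_le_const
    (C := 3 / 2 * ‖z‖) fun s hs => ?_).trans (by simp)
  rw [Set.uIoc_of_le zero_le_one] at hs
  have hsn : ‖(s : ℂ)‖ = s := Complex.norm_of_nonneg hs.1.le
  have hz' : ‖(s : ℂ) * z‖ ≤ 1 / 2 := by
    rw [norm_mul, hsn]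
    nlinarith [hs.2, norm_nonneg z]
  have := norm_log_one_sub_le hz'
  rw [norm_div, hsn, div_le_iff₀ hs.1]
  rw [norm_mul, hsn] at this
  linarith

lemma tendsto_log_mul_log :
    Tendsto (fun z : ℂ => Complex.log z * Complex.log (1 - z)) (𝓝 0) (𝓝 0) := by
  have h1 : Tendsto (fun z : ℂ => 3 / 2 * (|‖z‖ * Real.log ‖z‖| + ‖z‖ * Real.pi)) (𝓝 0) (𝓝 0) := by
    have hc : Continuous fun z : ℂ => 3 / 2 * (|‖z‖ * Real.log ‖z‖| + ‖z‖ * Real.pi) := by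
      have := Real.continuous_mul_log.comp (continuous_norm (E := ℂ))
      have h := this.abs
      simp only [Function.comp_def] at h
      fun_prop
    simpa using hc.tendsto 0
  refine squeeze_zero_norm' ?_ h1
  have hball : ∀ᶠ z : ℂ in 𝓝 0, ‖z‖ < 1 / 2 := by
    filter_upwards [Metric.ball_mem_nhds (0 : ℂ) (by norm_num : (0 : ℝ) < 1 / 2)] with z hz
    simpa using hz
  filter_upwards [hball] with z hz
  rw [norm_mul, abs_mul, abs_norm]
  calc ‖Complex.log z‖ * ‖Complex.log (1 - z)‖
      ≤ (|Real.log ‖z‖| + Real.pi) * (3 / 2 * ‖z‖) := by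
        gcongr
        · exact norm_log_le z
        · exact norm_log_one_sub_le hz.le
    _ = _ := by ring

/-- Euler's reflection formula on the positive reals. -/
lemma dilog_reflection_ofReal {x : ℝ} (hx : 0 < x) :
    dilog x + dilog (1 - x) + Complex.log x * Complex.log (1 - x) = (Real.pi : ℂ) ^ 2 / 6 := by
  set Φ : ℝ → ℂ := fun u => dilog u + dilog (1 - u) + Complex.log u * Complex.log (1 - u) with hΦ
  have hslit : ∀ u : ℝ, 0 < u → 1 - (1 - (u : ℂ)) ∈ slitPlane := fun u hu => by
    left
    simpa using hu
  have hderiv : ∀ u : ℝ, 0 < u → u ≠ 1 → HasDerivAt Φ 0 u := by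
    intro u hu hu1
    have hu0 : (u : ℂ) ≠ 0 := by exact_mod_cast hu.ne'
    have hu1' : 1 - (u : ℂ) ≠ 0 := sub_ne_zero.2 (by exact_mod_cast hu1.symm)
    have h1 := hasDerivAt_dilog_ofReal hu hu1
    have h2 : HasDerivAt (fun u : ℝ => dilog (1 - (u : ℂ)))
        (-Complex.log (1 - (1 - (u : ℂ))) / (1 - (u : ℂ)) * (-1)) u :=
      ((hasDerivAt_dilog (hslit u hu) hu1').comp (u : ℂ)
        ((hasDerivAt_id (u : ℂ)).const_sub 1)).comp_ofReal
    have h3 : HasDerivAt (fun u : ℝ => Complex.log (u : ℂ)) (1 / (u : ℂ)) u :=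
      ((hasDerivAt_id (u : ℂ)).clog (Or.inl (by simpa using hu))).comp_ofReal
    have h4 := hasDerivAt_log_one_sub_ofReal hu1
    refine ((h1.add h2).add (h3.mul h4)).congr_deriv ?_
    rw [sub_sub_cancel]
    field_simp
    ring
  have hcont : ∀ u : ℝ, 0 < u → ContinuousAt Φ u := by
    intro u hu
    rcases eq_or_ne u 1 with rfl | hu1
    · have h1 : ContinuousAt (fun u : ℝ => dilog (1 - (u : ℂ))) 1 := by
        refine ContinuousAt.comp (g := dilog) (f := fun u : ℝ => 1 - (u : ℂ)) ?_ (by fun_prop)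
        simpa [ContinuousAt, dilog_zero] using tendsto_dilog_zero
      have h2 : ContinuousAt (fun u : ℝ => Complex.log (u : ℂ) * Complex.log (1 - (u : ℂ))) 1 := by
        have ht : Tendsto (fun u : ℝ => 1 - (u : ℂ)) (𝓝 1) (𝓝 0) := by
          have hc : Continuous fun u : ℝ => 1 - (u : ℂ) := by fun_prop
          simpa using hc.tendsto 1
        have := tendsto_log_mul_log.comp ht
        simpa [ContinuousAt, Function.comp_def, mul_comm] using this
      exact ((continuousAt_dilog_ofReal one_pos).add h1).add h2
    · exact (hderiv u hu hu1).continuousAt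
  have hpos : ∀ u ∈ Set.uIcc 1 x, 0 < u := fun u hu =>
    lt_of_lt_of_le (lt_min one_pos hx) hu.1
  have h := integral_eq_of_hasDerivAt_off_countable Φ (fun _ => 0) (a := 1) (b := x) (s := {1})
    (Set.countable_singleton 1) (fun u hu => (hcont u (hpos u hu)).continuousWithinAt)
    (fun u hu => hderiv u (hpos u (Set.Ioo_subset_Icc_self hu.1)) hu.2)
    intervalIntegrable_const
  rw [intervalIntegral.integral_zero] at h
  have h' : Φ x = Φ 1 := (sub_eq_zero.1 h.symm)
  simpa [hΦ, dilog_one, dilog_zero] using h'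

/-- Euler's reflection formula. -/
lemma dilog_reflection {z : ℂ} (hz : z ∈ slitPlane) :
    dilog z + dilog (1 - z) + Complex.log z * Complex.log (1 - z) = (Real.pi : ℂ) ^ 2 / 6 := by
  by_cases hz1 : 1 - z ∈ slitPlane
  · have hhalf : ((1 / 2 : ℝ) : ℂ) ∈ slitPlane := Or.inl (by norm_num)
    have hhalf' : 1 - ((1 / 2 : ℝ) : ℂ) ∈ slitPlane := Or.inl (by norm_num)
    set P : Set ℂ := {w | w ∈ slitPlane ∧ 1 - w ∈ slitPlane}
    have hopen : IsOpen P :=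
      isOpen_slitPlane.inter (isOpen_slitPlane.preimage (by fun_prop))
    have hstar : StarConvex ℝ ((1 / 2 : ℝ) : ℂ) P := by
      intro w hw a b ha hb hab
      have h2 : (0 : ℝ) < 1 / 2 := by norm_num
      refine ⟨starConvex_ofReal_slitPlane h2 hw.1 ha hb hab, ?_⟩
      have := starConvex_ofReal_slitPlane h2 hw.2 ha hb hab
      convert this using 1
      have hab' : (a : ℂ) + b = 1 := by exact_mod_cast hab
      simp only [Complex.real_smul]
      push_cast
      linear_combination (-1 : ℂ) * hab'
    have hderiv : ∀ w ∈ P, HasDerivAt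
        (fun w => dilog w + dilog (1 - w) + Complex.log w * Complex.log (1 - w)) 0 w := by
      intro w hw
      have hw0 := slitPlane_ne_zero hw.1
      have hw1 := slitPlane_ne_zero hw.2
      have h2 : HasDerivAt (fun w => dilog (1 - w))
          (-Complex.log (1 - (1 - w)) / (1 - w) * (-1)) w :=
        (hasDerivAt_dilog (by simpa using hw.1) hw1).comp w ((hasDerivAt_id w).const_sub 1)
      refine (((hasDerivAt_dilog hw.2 hw0).add h2).add
        (((hasDerivAt_id w).clog hw.1).mul (hasDerivAt_log_one_sub hw.2))).congr_deriv ?_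
      rw [sub_sub_cancel]
      simp only [id]
      field_simp
      ring
    have hconst := hopen.is_const_of_deriv_eq_zero
      (hstar.isPathConnected ⟨hhalf, hhalf'⟩).isConnected.isPreconnected
      (fun w hw => (hderiv w hw).differentiableAt.differentiableWithinAt)
      (fun w hw => (hderiv w hw).deriv) (x := z) (y := ((1 / 2 : ℝ) : ℂ)) ⟨hz, hz1⟩ ⟨hhalf, hhalf'⟩
    exact hconst.trans (dilog_reflection_ofReal (by norm_num))
  · have him : z.im = 0 := by
      by_contra h
      exact hz1 (Or.inr (by simpa using h))
    have hre : 0 < z.re := by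
      rcases hz with h | h
      · exact h
      · exact absurd him h
    have hzr : z = (z.re : ℂ) := Complex.ext (by simp) (by simp [him])
    rw [hzr]
    exact dilog_reflection_ofReal hre

/-- The Rogers dilogarithm tends to `0` at `0`. -/
lemma tendsto_rogers_zero : Tendsto rogers (𝓝 0) (𝓝 0) := by
  have h := (tendsto_log_mul_log.const_mul (1 / 2)).add tendsto_dilog_zero
  simp only [mul_zero, add_zero] at h
  refine h.congr fun z => ?_
  rw [rogers_eq]
  ring

lemma Cpi_ne_zero : Cpi ≠ 0 := by
  rw [Cpi]
  exact_mod_cast Real.pi_ne_zero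

lemma exp_int_mul_Cpi_I (n : ℤ) : exp (n * (Cpi * I)) = (-1) ^ n := by
  rw [Complex.exp_int_mul, Cpi, Complex.exp_pi_mul_I]

lemma exp_two_mul_eq_one_iff {f : ℂ} : exp (2 * f) = 1 ↔ ∃ n : ℤ, f = n * (Cpi * I) := by
  rw [Complex.exp_eq_one_iff]
  refine exists_congr fun n => ⟨fun h => ?_, fun h => ?_⟩
  · rw [Cpi]
    linear_combination h / 2
  · rw [h, Cpi]
    ring

/-- A logarithm of a sign which is small has to vanish. -/
lemma eq_zero_of_exp_two_mul {f : ℂ} (h : exp (2 * f) = 1) (hf : ‖f‖ < 1) : f = 0 := by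
  obtain ⟨n, rfl⟩ := exp_two_mul_eq_one_iff.1 h
  rcases eq_or_ne n 0 with rfl | hn
  · simp
  · exfalso
    have h1 : (1 : ℝ) ≤ |(n : ℝ)| := by exact_mod_cast Int.one_le_abs hn
    rw [norm_mul, norm_mul, Complex.norm_I, mul_one, Complex.norm_intCast, Cpi,
      Complex.norm_of_nonneg Real.pi_pos.le] at hf
    nlinarith [Real.pi_gt_three]

lemma eventually_eq_zero_of_exp_two_mul {α : Type*} {l : Filter α} {f : α → ℂ}
    (hf : Tendsto f l (𝓝 0)) (h : ∀ᶠ w in l, exp (2 * f w) = 1) : ∀ᶠ w in l, f w = 0 := by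
  have h1 : ∀ᶠ w in l, ‖f w‖ < 1 := hf.norm.eventually_lt_const (by simp)
  filter_upwards [h, h1] with w hw hw1 using eq_zero_of_exp_two_mul hw hw1

/-- On a preconnected set, a continuous logarithm of a sign is constant. -/
lemma eq_zero_of_exp_two_mul_of_isPreconnected {α : Type*} [TopologicalSpace α] {S : Set α}
    (hS : IsPreconnected S) {f : α → ℂ} (hf : ContinuousOn f S)
    (h : ∀ w ∈ S, exp (2 * f w) = 1) {x y : α} (hx : x ∈ S) (hy : y ∈ S) (hfx : f x = 0) :
    f y = 0 := by
  have key : f x = f y := by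
    refine hS.induction₂ (fun x y => f x = f y) (fun u hu => ?_)
      (fun _ _ _ _ _ _ h1 h2 => h1.trans h2) (fun _ _ _ _ h1 => h1.symm) hx hy
    have ht : Tendsto (fun w => f w - f u) (𝓝[S] u) (𝓝 0) := by
      simpa using (hf u hu).sub_const (f u)
    have he := eventually_eq_zero_of_exp_two_mul ht (by
      filter_upwards [self_mem_nhdsWithin] with w hw
      rw [mul_sub, Complex.exp_sub, h w hw, h u hu, div_one])
    filter_upwards [he] with w hw using (sub_eq_zero.1 hw).symm
  rw [← key, hfx]

/-- The projection of `𝓒` to `ℂ ∖ {0,1}`, extended to an entire function on `ℂ²`. -/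
def proj (w : ℂ × ℂ) : ℂ := (exp (2 * w.1) - exp (-(2 * w.2)) + 1) / 2

lemma continuous_proj : Continuous proj := by
  unfold proj
  fun_prop

lemma exp_two_mul_pt_fst {z : ℂ} (h : Reg z) (p q : ℤ) : exp (2 * (pt z p q).1) = z ^ 2 := by
  have h1 : exp (2 * (p * (Cpi * I))) = 1 := exp_two_mul_eq_one_iff.2 ⟨p, rfl⟩
  rw [pt, mul_add, Complex.exp_add, h1, mul_one, two_mul, Complex.exp_add, Complex.exp_log h.1, sq]

lemma exp_neg_two_mul_pt_snd {z : ℂ} (h : Reg z) (p q : ℤ) :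
    exp (-(2 * (pt z p q).2)) = (1 - z) ^ 2 := by
  have h1 : exp (2 * (q * (Cpi * I))) = 1 := exp_two_mul_eq_one_iff.2 ⟨q, rfl⟩
  have h2 : 1 - z ≠ 0 := sub_ne_zero.2 h.2.symm
  have h3 : -(2 * (pt z p q).2) =
      Complex.log (1 - z) + Complex.log (1 - z) - 2 * (q * (Cpi * I)) := by
    rw [pt]
    ring
  rw [h3, Complex.exp_sub, h1, div_one, Complex.exp_add, Complex.exp_log h2, sq]

lemma LiesOver.exp_fst {w : ℂ × ℂ} {z : ℂ} (h : LiesOver w z) : exp (2 * w.1) = z ^ 2 := by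
  obtain ⟨hz, p, q, rfl⟩ := h
  exact exp_two_mul_pt_fst hz p q

lemma LiesOver.exp_snd {w : ℂ × ℂ} {z : ℂ} (h : LiesOver w z) :
    exp (-(2 * w.2)) = (1 - z) ^ 2 := by
  obtain ⟨hz, p, q, rfl⟩ := h
  exact exp_neg_two_mul_pt_snd hz p q

lemma LiesOver.proj_eq {w : ℂ × ℂ} {z : ℂ} (h : LiesOver w z) : proj w = z := by
  rw [proj, h.exp_fst, h.exp_snd]
  ring

lemma LiesOver.mem_Cover {w : ℂ × ℂ} {z : ℂ} (h : LiesOver w z) : w ∈ Cover := ⟨z, h⟩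

lemma liesOver_proj {w : ℂ × ℂ} (h : w ∈ Cover) : LiesOver w (proj w) := by
  obtain ⟨z, hz⟩ := h
  have : LiesOver w z := hz
  rwa [this.proj_eq]

lemma liesOver_pt {z : ℂ} (h : Reg z) (p q : ℤ) : LiesOver (pt z p q) z := ⟨h, p, q, rfl⟩

lemma liesOver_of_exp {w : ℂ × ℂ} {z : ℂ} (hz : Reg z) (h1 : exp (2 * w.1) = z ^ 2)
    (h2 : exp (-(2 * w.2)) = (1 - z) ^ 2) : LiesOver w z := by
  have hz1 : 1 - z ≠ 0 := sub_ne_zero.2 hz.2.symm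
  obtain ⟨p, hp⟩ := (exp_two_mul_eq_one_iff (f := w.1 - Complex.log z)).1 (by
    rw [mul_sub, Complex.exp_sub, h1, two_mul, Complex.exp_add, Complex.exp_log hz.1, ← sq,
      div_self (pow_ne_zero 2 hz.1)])
  obtain ⟨q, hq⟩ := (exp_two_mul_eq_one_iff (f := w.2 + Complex.log (1 - z))).1 (by
    rw [← inv_inj, inv_one, ← Complex.exp_neg]
    have : -(2 * (w.2 + Complex.log (1 - z))) =
        -(2 * w.2) - (Complex.log (1 - z) + Complex.log (1 - z)) := by ring
    rw [this, Complex.exp_sub, h2, Complex.exp_add, Complex.exp_log hz1, ← sq,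
      div_self (pow_ne_zero 2 hz1)])
  refine ⟨hz, p, q, Prod.ext ?_ ?_⟩
  · simp only [pt]
    linear_combination hp
  · simp only [pt]
    linear_combination hq

lemma Cpi_I_mul_int_inj {a b : ℤ} (h : (a : ℂ) * (Cpi * I) = b * (Cpi * I)) : a = b := by
  have := mul_right_cancel₀ (mul_ne_zero Cpi_ne_zero I_ne_zero) h
  exact_mod_cast this

lemma pt_injective {z z' : ℂ} (h : Reg z) (h' : Reg z') {p q p' q' : ℤ}
    (he : pt z p q = pt z' p' q') : z = z' ∧ p = p' ∧ q = q' := by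
  have hz : z = z' := by
    rw [← (liesOver_pt h p q).proj_eq, he, (liesOver_pt h' p' q').proj_eq]
  subst hz
  simp only [pt, Prod.mk.injEq, add_right_inj] at he
  exact ⟨rfl, Cpi_I_mul_int_inj he.1, Cpi_I_mul_int_inj he.2⟩

/-- The extended Rogers dilogarithm on `𝓒` with values in `ℂ/π²ℤ`, extended by `0` to `ℂ²`. -/
def rogersMod (w : ℂ × ℂ) : ModPiSq :=
  if h : w ∈ Cover then QuotientAddGroup.mk
    (Rfun h.choose h.choose_spec.2.choose h.choose_spec.2.choose_spec.choose) else 0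

lemma rogersMod_pt {z : ℂ} (h : Reg z) (p q : ℤ) :
    rogersMod (pt z p q) = QuotientAddGroup.mk (Rfun z p q) := by
  have hc : pt z p q ∈ Cover := pt_mem_Cover h p q
  rw [rogersMod, dif_pos hc]
  obtain ⟨h1, h2, h3⟩ := pt_injective h hc.choose_spec.1
    hc.choose_spec.2.choose_spec.choose_spec
  exact congrArg _ (congr (congr (congrArg Rfun h1.symm) h2.symm) h3.symm)

lemma mk_eq_mk_of_sub {a b : ℂ} (n : ℤ) (h : a - b = n * Cpi ^ 2) :
    (QuotientAddGroup.mk a : ModPiSq) = QuotientAddGroup.mk b := by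
  rw [QuotientAddGroup.eq, AddSubgroup.mem_zmultiples_iff]
  refine ⟨-n, ?_⟩
  rw [zsmul_eq_mul]
  push_cast
  linear_combination h

/-- Expression of `R` in the coordinates of `𝓒`, adapted to the complement of `[1, ∞)`. -/
lemma Rfun_eq_dilog (z : ℂ) (p q : ℤ) :
    Rfun z p q = dilog z - 1 / 2 * (pt z p q).1 * (pt z p q).2 + q * (Cpi * I) * (pt z p q).1
      + 1 / 2 * p * q * Cpi ^ 2 - Cpi ^ 2 / 6 := by
  rw [Rfun, rogers_eq, pt]
  linear_combination (-(1 / 2) * p * q * Cpi ^ 2) * I_sq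

/-- Expression of `R` in the coordinates of `𝓒`, adapted to the complement of `(-∞, 0]`. -/
lemma Rfun_eq_dilog_one_sub {z : ℂ} (hz : z ∈ slitPlane) (p q : ℤ) :
    Rfun z p q = -dilog (1 - z) + 1 / 2 * (pt z p q).1 * (pt z p q).2
      - p * (Cpi * I) * (pt z p q).2 - 1 / 2 * p * q * Cpi ^ 2 := by
  rw [Rfun, rogers_eq, pt]
  have h := dilog_reflection hz
  simp only [Cpi] at *
  linear_combination h + ((1 / 2) * p * q * Real.pi ^ 2) * I_sq

lemma even_sub_of_neg_one_zpow_eq {a b : ℤ} (h : (-1 : ℂ) ^ a = (-1) ^ b) : Even (a - b) := by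
  have h1 : (-1 : ℂ) ^ (a - b) = 1 := by
    rw [zpow_sub₀ (by norm_num), h, div_self (zpow_ne_zero _ (by norm_num))]
  by_contra hodd
  rw [Int.not_even_iff_odd] at hodd
  rw [hodd.neg_one_zpow] at h1
  norm_num at h1

lemma exp_pt_fst {z : ℂ} (h : Reg z) (p q : ℤ) : exp (pt z p q).1 = z * (-1) ^ p := by
  rw [pt, Complex.exp_add, Complex.exp_log h.1, exp_int_mul_Cpi_I]

lemma exp_neg_pt_snd {z : ℂ} (h : Reg z) (p q : ℤ) :
    exp (-(pt z p q).2) = (1 - z) * (-1) ^ q := by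
  have h3 : -(pt z p q).2 = Complex.log (1 - z) + (-q : ℤ) * (Cpi * I) := by
    rw [pt]
    push_cast
    ring
  rw [h3, Complex.exp_add, Complex.exp_log (sub_ne_zero.2 h.2.symm), exp_int_mul_Cpi_I, zpow_neg,
    ← inv_zpow]
  norm_num

section LocalStructure

variable {z₀ : ℂ} {p₀ q₀ : ℤ}

lemma tendsto_proj (h₀ : Reg z₀) :
    Tendsto proj (𝓝[Cover] (pt z₀ p₀ q₀)) (𝓝 z₀) := by
  have := (continuous_proj.tendsto (pt z₀ p₀ q₀)).mono_left (nhdsWithin_le_nhds (s := Cover))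
  rwa [(liesOver_pt h₀ p₀ q₀).proj_eq] at this

/-- Near a point of `𝓒` the first coordinate is determined by the projection. -/
lemma eventually_fst_eq (h₀ : Reg z₀) : ∀ᶠ w in 𝓝[Cover] (pt z₀ p₀ q₀),
    w.1 = (pt z₀ p₀ q₀).1 + Complex.log (proj w / z₀) := by
  have hlog : Tendsto (fun w => Complex.log (proj w / z₀)) (𝓝[Cover] (pt z₀ p₀ q₀)) (𝓝 0) := by
    have h1 : Tendsto (fun w => proj w / z₀) (𝓝[Cover] (pt z₀ p₀ q₀)) (𝓝 1) := by
      simpa [div_self h₀.1] using (tendsto_proj (p₀ := p₀) (q₀ := q₀) h₀).div_const z₀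
    simpa using h1.clog one_mem_slitPlane
  have hfst : Tendsto (fun w : ℂ × ℂ => w.1) (𝓝[Cover] (pt z₀ p₀ q₀)) (𝓝 (pt z₀ p₀ q₀).1) :=
    (continuous_fst.tendsto _).mono_left nhdsWithin_le_nhds
  have ht := (hfst.sub_const (pt z₀ p₀ q₀).1).sub hlog
  rw [sub_self, sub_zero] at ht
  have := eventually_eq_zero_of_exp_two_mul ht (by
    filter_upwards [self_mem_nhdsWithin] with w hw
    have hl := liesOver_proj hw
    have hne : proj w / z₀ ≠ 0 := div_ne_zero hl.1.1 h₀.1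
    have he : 2 * (w.1 - (pt z₀ p₀ q₀).1 - Complex.log (proj w / z₀)) =
        2 * w.1 - 2 * (pt z₀ p₀ q₀).1 -
          (Complex.log (proj w / z₀) + Complex.log (proj w / z₀)) := by ring
    rw [he, Complex.exp_sub, Complex.exp_sub, hl.exp_fst, exp_two_mul_pt_fst h₀, Complex.exp_add,
      Complex.exp_log hne, ← sq, div_pow]
    exact div_self (div_ne_zero (pow_ne_zero 2 hl.1.1) (pow_ne_zero 2 h₀.1)))
  filter_upwards [this] with w hw
  linear_combination hw

/-- Near a point of `𝓒` the second coordinate is determined by the projection. -/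
lemma eventually_snd_eq (h₀ : Reg z₀) : ∀ᶠ w in 𝓝[Cover] (pt z₀ p₀ q₀),
    w.2 = (pt z₀ p₀ q₀).2 - Complex.log ((1 - proj w) / (1 - z₀)) := by
  have h1z : 1 - z₀ ≠ 0 := sub_ne_zero.2 h₀.2.symm
  have hlog : Tendsto (fun w => Complex.log ((1 - proj w) / (1 - z₀)))
      (𝓝[Cover] (pt z₀ p₀ q₀)) (𝓝 0) := by
    have h1 : Tendsto (fun w => (1 - proj w) / (1 - z₀)) (𝓝[Cover] (pt z₀ p₀ q₀)) (𝓝 1) := by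
      simpa [div_self h1z] using
        ((tendsto_proj (p₀ := p₀) (q₀ := q₀) h₀).const_sub 1).div_const (1 - z₀)
    simpa using h1.clog one_mem_slitPlane
  have hsnd : Tendsto (fun w : ℂ × ℂ => w.2) (𝓝[Cover] (pt z₀ p₀ q₀)) (𝓝 (pt z₀ p₀ q₀).2) :=
    (continuous_snd.tendsto _).mono_left nhdsWithin_le_nhds
  have ht := ((hsnd.const_sub (pt z₀ p₀ q₀).2)).sub hlog
  rw [sub_self, sub_zero] at ht
  have := eventually_eq_zero_of_exp_two_mul ht (by
    filter_upwards [self_mem_nhdsWithin] with w hw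
    have hl := liesOver_proj hw
    have h1w : 1 - proj w ≠ 0 := sub_ne_zero.2 hl.1.2.symm
    have hne : (1 - proj w) / (1 - z₀) ≠ 0 := div_ne_zero h1w h1z
    have he : 2 * ((pt z₀ p₀ q₀).2 - w.2 - Complex.log ((1 - proj w) / (1 - z₀))) =
        -(2 * w.2) - -(2 * (pt z₀ p₀ q₀).2) -
          (Complex.log ((1 - proj w) / (1 - z₀)) + Complex.log ((1 - proj w) / (1 - z₀))) := by
      ring
    rw [he, Complex.exp_sub, Complex.exp_sub, hl.exp_snd, exp_neg_two_mul_pt_snd h₀,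
      Complex.exp_add, Complex.exp_log hne, ← sq, div_pow]
    exact div_self (div_ne_zero (pow_ne_zero 2 h1w) (pow_ne_zero 2 h1z)))
  filter_upwards [this] with w hw
  linear_combination -hw

/-- Near a point of `𝓒`, the parities of both sheet numbers are constant. -/
lemma eventually_even (h₀ : Reg z₀) : ∀ᶠ w in 𝓝[Cover] (pt z₀ p₀ q₀),
    ∀ p q : ℤ, w = pt (proj w) p q → Even (p - p₀) ∧ Even (q - q₀) := by
  filter_upwards [eventually_fst_eq h₀, eventually_snd_eq h₀, self_mem_nhdsWithin]
    with w h1 h2 hw p q hpq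
  have hr := (liesOver_proj hw).1
  have h1z : 1 - z₀ ≠ 0 := sub_ne_zero.2 h₀.2.symm
  have h1w : 1 - proj w ≠ 0 := sub_ne_zero.2 hr.2.symm
  constructor
  · have h := congrArg exp h1
    rw [Complex.exp_add, exp_pt_fst h₀, Complex.exp_log (div_ne_zero hr.1 h₀.1)] at h
    rw [hpq, exp_pt_fst hr, ← hpq] at h
    refine even_sub_of_neg_one_zpow_eq (mul_left_cancel₀ hr.1 ?_)
    rw [h]
    field_simp [h₀.1]
  · have h := congrArg (fun u => exp (-u)) h2
    simp only [neg_sub'] at h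
    rw [Complex.exp_sub, exp_neg_pt_snd h₀, Complex.exp_neg (Complex.log _),
      Complex.exp_log (div_ne_zero h1w h1z)] at h
    rw [hpq, exp_neg_pt_snd hr, ← hpq] at h
    refine even_sub_of_neg_one_zpow_eq (mul_left_cancel₀ h1w ?_)
    rw [h]
    field_simp

/-- The derivative of the extended Rogers dilogarithm: the form `½ (b da - a db)`. -/
def rogersForm (w : ℂ × ℂ) : ℂ × ℂ →L[ℂ] ℂ :=
  (w.2 / 2) • ContinuousLinearMap.fst ℂ ℂ ℂ - (w.1 / 2) • ContinuousLinearMap.snd ℂ ℂ ℂ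

lemma exists_primitive_of_one_sub_mem_slitPlane (h₀ : Reg z₀) (hs : 1 - z₀ ∈ slitPlane) :
    ∃ G : ℂ × ℂ → ℂ, ∀ᶠ w in 𝓝[Cover] (pt z₀ p₀ q₀),
      rogersMod w = QuotientAddGroup.mk (G w) ∧ HasFDerivAt G (rogersForm w) w := by
  set w₀ := pt z₀ p₀ q₀ with hw₀
  refine ⟨fun w => dilog (z₀ * exp (w.1 - w₀.1)) - 1 / 2 * w.1 * w.2 + q₀ * (Cpi * I) * w.1
      + 1 / 2 * p₀ * q₀ * Cpi ^ 2 - Cpi ^ 2 / 6, ?_⟩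
  have htp := tendsto_proj (p₀ := p₀) (q₀ := q₀) h₀
  have hsl : ∀ᶠ w in 𝓝[Cover] w₀, 1 - proj w ∈ slitPlane :=
    (htp.const_sub 1).eventually (isOpen_slitPlane.mem_nhds hs)
  have hq : ∀ᶠ w in 𝓝[Cover] w₀, w.2 + Complex.log (1 - proj w) - q₀ * (Cpi * I) = 0 := by
    refine eventually_eq_zero_of_exp_two_mul ?_ ?_
    · have hsnd : Tendsto (fun w : ℂ × ℂ => w.2) (𝓝[Cover] w₀) (𝓝 w₀.2) :=
        (continuous_snd.tendsto _).mono_left nhdsWithin_le_nhds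
      have := (hsnd.add ((htp.const_sub 1).clog hs)).sub_const (q₀ * (Cpi * I))
      convert this using 2
      rw [hw₀, pt]
      ring
    · filter_upwards [self_mem_nhdsWithin] with w hw
      obtain ⟨_, p, q, hpq⟩ := liesOver_proj hw
      refine exp_two_mul_eq_one_iff.2 ⟨q - q₀, ?_⟩
      have := congrArg Prod.snd hpq
      simp only [pt] at this
      push_cast
      linear_combination this
  filter_upwards [self_mem_nhdsWithin, hsl, hq, eventually_fst_eq h₀, eventually_even h₀]
    with w hw hslit hqw h1 hev
  obtain ⟨hr, p, q, hpq⟩ := liesOver_proj hw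
  have hz : z₀ * exp (w.1 - w₀.1) = proj w := by
    rw [h1, hw₀, add_sub_cancel_left, Complex.exp_log (div_ne_zero hr.1 h₀.1)]
    field_simp [h₀.1]
  constructor
  · have hqq : q = q₀ := by
      have := congrArg Prod.snd hpq
      simp only [pt] at this
      refine Cpi_I_mul_int_inj ?_
      linear_combination hqw - this
    obtain ⟨m, hm⟩ := (hev p q hpq).1
    subst hqq
    have hp : (p : ℂ) = p₀ + 2 * m := by
      have : p = p₀ + 2 * m := by linarith
      exact_mod_cast this
    have hR := rogersMod_pt hr p q
    have hRf := Rfun_eq_dilog (proj w) p q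
    rw [← hpq] at hR hRf
    rw [hR, hRf]
    refine mk_eq_mk_of_sub (m * q) ?_
    rw [hz, hp]
    push_cast
    ring
  · have hd : HasFDerivAt (fun w : ℂ × ℂ => z₀ * exp (w.1 - w₀.1))
        (z₀ • (exp (w.1 - w₀.1) • ContinuousLinearMap.fst ℂ ℂ ℂ)) w :=
      ((hasFDerivAt_fst.sub_const w₀.1).cexp).const_mul z₀
    have hdil := (hasDerivAt_dilog (z := z₀ * exp (w.1 - w₀.1)) (by rwa [hz])
      (by rw [hz]; exact hr.1)).comp_hasFDerivAt w hd
    have hA : HasFDerivAt (fun w : ℂ × ℂ => w.1) (ContinuousLinearMap.fst ℂ ℂ ℂ) w :=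
      hasFDerivAt_fst
    have hB : HasFDerivAt (fun w : ℂ × ℂ => w.2) (ContinuousLinearMap.snd ℂ ℂ ℂ) w :=
      hasFDerivAt_snd
    have := ((((hdil.sub ((hA.const_mul (1 / 2)).mul hB)).add
      (hA.const_mul (q₀ * (Cpi * I))))).add_const (1 / 2 * p₀ * q₀ * Cpi ^ 2)).sub_const
        (Cpi ^ 2 / 6)
    refine this.congr_fderiv ?_
    have hz1 : -Complex.log (1 - z₀ * exp (w.1 - w₀.1)) / (z₀ * exp (w.1 - w₀.1)) *
        (z₀ * exp (w.1 - w₀.1)) = w.2 - q₀ * (Cpi * I) := by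
      rw [hz, div_mul_cancel₀ _ hr.1]
      linear_combination -hqw
    refine ContinuousLinearMap.ext fun v => ?_
    simp [rogersForm]
    linear_combination v.1 * hz1

lemma exists_primitive_of_mem_slitPlane (h₀ : Reg z₀) (hs : z₀ ∈ slitPlane) :
    ∃ G : ℂ × ℂ → ℂ, ∀ᶠ w in 𝓝[Cover] (pt z₀ p₀ q₀),
      rogersMod w = QuotientAddGroup.mk (G w) ∧ HasFDerivAt G (rogersForm w) w := by
  set w₀ := pt z₀ p₀ q₀ with hw₀
  refine ⟨fun w => -dilog ((1 - z₀) * exp (w₀.2 - w.2)) + 1 / 2 * w.1 * w.2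
      - p₀ * (Cpi * I) * w.2 - 1 / 2 * p₀ * q₀ * Cpi ^ 2, ?_⟩
  have h1z : 1 - z₀ ≠ 0 := sub_ne_zero.2 h₀.2.symm
  have htp := tendsto_proj (p₀ := p₀) (q₀ := q₀) h₀
  have hsl : ∀ᶠ w in 𝓝[Cover] w₀, proj w ∈ slitPlane :=
    htp.eventually (isOpen_slitPlane.mem_nhds hs)
  have hp : ∀ᶠ w in 𝓝[Cover] w₀, w.1 - Complex.log (proj w) - p₀ * (Cpi * I) = 0 := by
    refine eventually_eq_zero_of_exp_two_mul ?_ ?_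
    · have hfst : Tendsto (fun w : ℂ × ℂ => w.1) (𝓝[Cover] w₀) (𝓝 w₀.1) :=
        (continuous_fst.tendsto _).mono_left nhdsWithin_le_nhds
      have := (hfst.sub (htp.clog hs)).sub_const (p₀ * (Cpi * I))
      convert this using 2
      rw [hw₀, pt]
      ring
    · filter_upwards [self_mem_nhdsWithin] with w hw
      obtain ⟨_, p, q, hpq⟩ := liesOver_proj hw
      refine exp_two_mul_eq_one_iff.2 ⟨p - p₀, ?_⟩
      have := congrArg Prod.fst hpq
      simp only [pt] at this
      push_cast
      linear_combination this
  filter_upwards [self_mem_nhdsWithin, hsl, hp, eventually_snd_eq h₀, eventually_even h₀]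
    with w hw hslit hpw h2 hev
  obtain ⟨hr, p, q, hpq⟩ := liesOver_proj hw
  have h1w : 1 - proj w ≠ 0 := sub_ne_zero.2 hr.2.symm
  have hz : (1 - z₀) * exp (w₀.2 - w.2) = 1 - proj w := by
    rw [h2, hw₀, sub_sub_cancel, Complex.exp_log (div_ne_zero h1w h1z)]
    field_simp
  constructor
  · have hpp : p = p₀ := by
      have := congrArg Prod.fst hpq
      simp only [pt] at this
      refine Cpi_I_mul_int_inj ?_
      linear_combination hpw - this
    obtain ⟨m, hm⟩ := (hev p q hpq).2
    subst hpp
    have hq : (q : ℂ) = q₀ + 2 * m := by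
      have : q = q₀ + 2 * m := by linarith
      exact_mod_cast this
    have hR := rogersMod_pt hr p q
    have hRf := Rfun_eq_dilog_one_sub hslit p q
    rw [← hpq] at hR hRf
    rw [hR, hRf]
    refine mk_eq_mk_of_sub (-(m * p)) ?_
    rw [hz, hq]
    push_cast
    ring
  · have hA : HasFDerivAt (fun w : ℂ × ℂ => w.1) (ContinuousLinearMap.fst ℂ ℂ ℂ) w :=
      hasFDerivAt_fst
    have hB : HasFDerivAt (fun w : ℂ × ℂ => w.2) (ContinuousLinearMap.snd ℂ ℂ ℂ) w :=
      hasFDerivAt_snd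
    have hd := ((hB.const_sub w₀.2).cexp).const_mul (1 - z₀)
    have hdil := (hasDerivAt_dilog (z := (1 - z₀) * exp (w₀.2 - w.2))
      (by rw [hz]; simpa using hslit) (by rwa [hz])).comp_hasFDerivAt w hd
    have := ((hdil.neg.add ((hA.const_mul (1 / 2)).mul hB)).sub
      (hB.const_mul (p₀ * (Cpi * I)))).sub_const (1 / 2 * p₀ * q₀ * Cpi ^ 2)
    refine this.congr_fderiv ?_
    have hz1 : -Complex.log (1 - (1 - z₀) * exp (w₀.2 - w.2)) / ((1 - z₀) * exp (w₀.2 - w.2)) *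
        ((1 - z₀) * exp (w₀.2 - w.2)) = p₀ * (Cpi * I) - w.1 := by
      rw [hz, div_mul_cancel₀ _ h1w, sub_sub_cancel]
      linear_combination hpw
    refine ContinuousLinearMap.ext fun v => ?_
    simp [rogersForm]
    linear_combination v.2 * hz1

end LocalStructure

/-- Locally on `𝓒`, the extended Rogers dilogarithm lifts to a primitive of `½ (b da - a db)`. -/
lemma exists_primitive {w₀ : ℂ × ℂ} (h : w₀ ∈ Cover) :
    ∃ G : ℂ × ℂ → ℂ, ∀ᶠ w in 𝓝[Cover] w₀,
      rogersMod w = QuotientAddGroup.mk (G w) ∧ HasFDerivAt G (rogersForm w) w := by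
  obtain ⟨z, hz, p, q, rfl⟩ := h
  by_cases hs : z ∈ slitPlane
  · exact exists_primitive_of_mem_slitPlane hz hs
  · refine exists_primitive_of_one_sub_mem_slitPlane hz (Or.inl ?_)
    rw [mem_slitPlane_iff, not_or, not_lt] at hs
    simp only [Complex.sub_re, Complex.one_re]
    linarith [hs.1]

lemma continuousOn_rogersMod : ContinuousOn rogersMod Cover := by
  intro w₀ hw₀
  obtain ⟨G, hG⟩ := exists_primitive hw₀
  have hself := hG.self_of_nhdsWithin hw₀
  have hcont : ContinuousWithinAt (fun w => (QuotientAddGroup.mk (G w) : ModPiSq)) Cover w₀ :=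
    (continuous_quot_mk.continuousAt.comp hself.2.continuousAt).continuousWithinAt
  exact hcont.congr_of_eventuallyEq (hG.mono fun w hw => hw.1) hself.1

/-- The linear parametrization of the coordinates of lifted five term tuples. -/
def ftCoords (a₀ b₀ a₁ b₁ b₂ : ℂ) : Fin 5 → ℂ × ℂ :=
  ![(a₀, b₀), (a₁, b₁), (a₁ - a₀, b₂), (a₁ - a₀ + b₁ - b₀, b₂ - b₁), (b₁ - b₀, b₂ - b₁ - a₀)]

/-- The lifts of five term tuples whose coordinates satisfy the five term linear relations. -/
def FTlin : Set (Fin 5 → ℂ × ℂ) :=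
  {w | w ∈ FTpre ∧ w = ftCoords (w 0).1 (w 0).2 (w 1).1 (w 1).2 (w 2).2}

/-- The alternating sum of the extended Rogers dilogarithm. -/
def fiveTerm (w : Fin 5 → ℂ × ℂ) : ModPiSq := ∑ i : Fin 5, (-1 : ℤ) ^ (i : ℕ) • rogersMod (w i)

lemma sum_zsmul_mk (f : Fin 5 → ℂ) :
    ∑ i : Fin 5, (-1 : ℤ) ^ (i : ℕ) • (QuotientAddGroup.mk (f i) : ModPiSq) =
      QuotientAddGroup.mk (∑ i : Fin 5, (-1 : ℂ) ^ (i : ℕ) * f i) := by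
  change _ = QuotientAddGroup.mk' _ (∑ i : Fin 5, (-1 : ℂ) ^ (i : ℕ) * f i)
  rw [map_sum]
  refine Finset.sum_congr rfl fun i _ => ?_
  have : (-1 : ℂ) ^ (i : ℕ) * f i = (-1 : ℤ) ^ (i : ℕ) • f i := by
    rw [zsmul_eq_mul]
    push_cast
    rfl
  rw [this, map_zsmul]
  rfl

lemma one_sub_ftTuple_three {x y : ℂ} (hx : Reg x) (hy : Reg y) :
    1 - (1 - x⁻¹) / (1 - y⁻¹) = (1 - y / x) / (1 - y) := by
  have h1 := hx.1
  have h2 := hy.1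
  have h3 : 1 - y ≠ 0 := sub_ne_zero.2 hy.2.symm
  have h4 : y - 1 ≠ 0 := sub_ne_zero.2 hy.2
  have h5 : 1 - y⁻¹ ≠ 0 := by
    rw [sub_ne_zero, ne_comm, inv_ne_one]
    exact hy.2
  have h6 : 1 - y⁻¹ = (y - 1) / y := by field_simp
  rw [h6]
  field_simp
  ring

lemma one_sub_ftTuple_four {x y : ℂ} (hx : Reg x) (hy : Reg y) :
    1 - (1 - x) / (1 - y) = x * (1 - y / x) / (1 - y) := by
  have h1 := hx.1
  have h3 : 1 - y ≠ 0 := sub_ne_zero.2 hy.2.symm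
  field_simp
  ring

lemma ftTuple_three {x y : ℂ} (hx : Reg x) (hy : Reg y) :
    (1 - x⁻¹) / (1 - y⁻¹) = y / x * ((1 - x) / (1 - y)) := by
  have h1 := hx.1
  have h2 := hy.1
  have h3 : 1 - y ≠ 0 := sub_ne_zero.2 hy.2.symm
  have h4 : y - 1 ≠ 0 := sub_ne_zero.2 hy.2
  have h6 : 1 - y⁻¹ = (y - 1) / y := by field_simp
  rw [h6]
  field_simp
  ring

lemma one_sub_div_ne_zero {x y : ℂ} (hx : Reg x) (hxy : x ≠ y) : 1 - y / x ≠ 0 := by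
  rw [sub_ne_zero, ne_comm, Ne, div_eq_one_iff_eq hx.1]
  exact hxy.symm

lemma reg_of_ne_zero {z : ℂ} (h : z ≠ 0) (h1 : 1 - z ≠ 0) : Reg z := ⟨h, (sub_ne_zero.1 h1).symm⟩

lemma reg_ftTuple {x y : ℂ} (hx : Reg x) (hy : Reg y) (hxy : x ≠ y) (i : Fin 5) :
    Reg (ftTuple x y i) := by
  have h1x : 1 - x ≠ 0 := sub_ne_zero.2 hx.2.symm
  have h1y : 1 - y ≠ 0 := sub_ne_zero.2 hy.2.symm
  have hd := one_sub_div_ne_zero hx hxy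
  have hq : y / x ≠ 0 := div_ne_zero hy.1 hx.1
  have h4 : (1 - x) / (1 - y) ≠ 0 := div_ne_zero h1x h1y
  fin_cases i
  · exact hx
  · exact hy
  · exact reg_of_ne_zero hq hd
  · refine reg_of_ne_zero ?_ ?_
    · refine (ftTuple_three hx hy).trans_ne ?_
      exact mul_ne_zero hq h4
    · refine (one_sub_ftTuple_three hx hy).trans_ne ?_
      exact div_ne_zero hd h1y
  · refine reg_of_ne_zero h4 ?_
    refine (one_sub_ftTuple_four hx hy).trans_ne ?_
    exact div_ne_zero (mul_ne_zero hx.1 hd) h1y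

lemma ftCoords_mem_FTlin {x y a₀ b₀ a₁ b₁ b₂ : ℂ} (hx : Reg x) (hy : Reg y) (hxy : x ≠ y)
    (ha₀ : exp (2 * a₀) = x ^ 2) (hb₀ : exp (-(2 * b₀)) = (1 - x) ^ 2)
    (ha₁ : exp (2 * a₁) = y ^ 2) (hb₁ : exp (-(2 * b₁)) = (1 - y) ^ 2)
    (hb₂ : exp (-(2 * b₂)) = (1 - y / x) ^ 2) : ftCoords a₀ b₀ a₁ b₁ b₂ ∈ FTlin := by
  refine ⟨⟨_, ⟨x, y, hx, hy, hxy, rfl⟩, fun i => ?_⟩, rfl⟩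
  refine liesOver_of_exp (reg_ftTuple hx hy hxy i) ?_ ?_
  · fin_cases i
    · exact ha₀
    · exact ha₁
    · change exp (2 * (a₁ - a₀)) = (y / x) ^ 2
      rw [mul_sub, Complex.exp_sub, ha₀, ha₁, div_pow]
    · change exp (2 * (a₁ - a₀ + b₁ - b₀)) = ((1 - x⁻¹) / (1 - y⁻¹)) ^ 2
      have : 2 * (a₁ - a₀ + b₁ - b₀) = 2 * a₁ - 2 * a₀ + (-(2 * b₀) - -(2 * b₁)) := by ring
      rw [this, Complex.exp_add, Complex.exp_sub, Complex.exp_sub, ha₀, ha₁, hb₀, hb₁,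
        ftTuple_three hx hy, mul_pow, div_pow, div_pow]
    · change exp (2 * (b₁ - b₀)) = ((1 - x) / (1 - y)) ^ 2
      have : 2 * (b₁ - b₀) = -(2 * b₀) - -(2 * b₁) := by ring
      rw [this, Complex.exp_sub, hb₀, hb₁, div_pow]
  · fin_cases i
    · exact hb₀
    · exact hb₁
    · exact hb₂
    · change exp (-(2 * (b₂ - b₁))) = (1 - (1 - x⁻¹) / (1 - y⁻¹)) ^ 2
      have : -(2 * (b₂ - b₁)) = -(2 * b₂) - -(2 * b₁) := by ring
      rw [this, Complex.exp_sub, hb₂, hb₁, one_sub_ftTuple_three hx hy, div_pow]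
    · change exp (-(2 * (b₂ - b₁ - a₀))) = (1 - (1 - x) / (1 - y)) ^ 2
      have : -(2 * (b₂ - b₁ - a₀)) = 2 * a₀ + -(2 * b₂) - -(2 * b₁) := by ring
      rw [this, Complex.exp_sub, Complex.exp_add, hb₂, hb₁, ha₀, one_sub_ftTuple_four hx hy, div_pow,
        mul_pow]

lemma eventually_fst_eq_of_mem {w₀ : ℂ × ℂ} (h : w₀ ∈ Cover) : ∀ᶠ w in 𝓝[Cover] w₀,
    w.1 = w₀.1 + Complex.log (proj w / proj w₀) := by
  obtain ⟨z, hz, p, q, rfl⟩ := h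
  rw [(liesOver_pt hz p q).proj_eq]
  exact eventually_fst_eq hz

lemma eventually_snd_eq_of_mem {w₀ : ℂ × ℂ} (h : w₀ ∈ Cover) : ∀ᶠ w in 𝓝[Cover] w₀,
    w.2 = w₀.2 - Complex.log ((1 - proj w) / (1 - proj w₀)) := by
  obtain ⟨z, hz, p, q, rfl⟩ := h
  rw [(liesOver_pt hz p q).proj_eq]
  exact eventually_snd_eq hz

lemma FTpre.mem_Cover {w : Fin 5 → ℂ × ℂ} (h : w ∈ FTpre) (i : Fin 5) : w i ∈ Cover := by
  obtain ⟨v, -, hv⟩ := h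
  exact (hv i).mem_Cover

lemma tendsto_apply_FTpre (w₀ : Fin 5 → ℂ × ℂ) (i : Fin 5) :
    Tendsto (fun w : Fin 5 → ℂ × ℂ => w i) (𝓝[FTpre] w₀) (𝓝[Cover] (w₀ i)) := by
  refine tendsto_nhdsWithin_of_tendsto_nhds_of_eventually_within _ ?_ ?_
  · exact ((continuous_apply i).tendsto w₀).mono_left nhdsWithin_le_nhds
  · filter_upwards [self_mem_nhdsWithin] with w hw using FTpre.mem_Cover hw i

lemma exp_two_mul_add_log_div {a x x₀ : ℂ} (hx : x ≠ 0) (hx₀ : x₀ ≠ 0)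
    (h : exp (2 * a) = x₀ ^ 2) : exp (2 * (a + Complex.log (x / x₀))) = x ^ 2 := by
  rw [mul_add, Complex.exp_add, h, two_mul, Complex.exp_add, Complex.exp_log (div_ne_zero hx hx₀)]
  field_simp

lemma exp_neg_two_mul_sub_log_div {b x x₀ : ℂ} (hx : x ≠ 0) (hx₀ : x₀ ≠ 0)
    (h : exp (-(2 * b)) = x₀ ^ 2) : exp (-(2 * (b - Complex.log (x / x₀)))) = x ^ 2 := by
  have := exp_two_mul_add_log_div (a := -b) hx hx₀ (by rwa [mul_neg])
  rw [← this]
  ring_nf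

section LocalConstancy

/-- The local section of `FTlin` through `w₀`, where `w₀` lies over `(x₀, y₀)`. -/
def ftSection (w₀ : Fin 5 → ℂ × ℂ) (x₀ y₀ : ℂ) (s : ℂ × ℂ) : Fin 5 → ℂ × ℂ :=
  ftCoords ((w₀ 0).1 + Complex.log (s.1 / x₀)) ((w₀ 0).2 - Complex.log ((1 - s.1) / (1 - x₀)))
    ((w₀ 1).1 + Complex.log (s.2 / y₀)) ((w₀ 1).2 - Complex.log ((1 - s.2) / (1 - y₀)))
    ((w₀ 2).2 - Complex.log ((1 - s.2 / s.1) / (1 - y₀ / x₀)))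

variable {w₀ : Fin 5 → ℂ × ℂ} {x₀ y₀ : ℂ}

lemma ftSection_self (hx : Reg x₀) (hy : Reg y₀) (hxy : x₀ ≠ y₀)
    (hlin : w₀ = ftCoords (w₀ 0).1 (w₀ 0).2 (w₀ 1).1 (w₀ 1).2 (w₀ 2).2) :
    ftSection w₀ x₀ y₀ (x₀, y₀) = w₀ := by
  conv_rhs => rw [hlin]
  simp only [ftSection, div_self hx.1, div_self hy.1, div_self (sub_ne_zero.2 hx.2.symm),
    div_self (sub_ne_zero.2 hy.2.symm), div_self (one_sub_div_ne_zero hx hxy), Complex.log_one,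
    add_zero, sub_zero]

lemma ftSection_mem_FTlin (hx : Reg x₀) (hy : Reg y₀) (hxy : x₀ ≠ y₀)
    (hover : ∀ i, LiesOver (w₀ i) (ftTuple x₀ y₀ i)) {s : ℂ × ℂ} (hs1 : Reg s.1) (hs2 : Reg s.2)
    (hs : s.1 ≠ s.2) : ftSection w₀ x₀ y₀ s ∈ FTlin := by
  refine ftCoords_mem_FTlin hs1 hs2 hs ?_ ?_ ?_ ?_ ?_
  · exact exp_two_mul_add_log_div hs1.1 hx.1 (hover 0).exp_fst
  · exact exp_neg_two_mul_sub_log_div (sub_ne_zero.2 hs1.2.symm) (sub_ne_zero.2 hx.2.symm)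
      (hover 0).exp_snd
  · exact exp_two_mul_add_log_div hs2.1 hy.1 (hover 1).exp_fst
  · exact exp_neg_two_mul_sub_log_div (sub_ne_zero.2 hs2.2.symm) (sub_ne_zero.2 hy.2.symm)
      (hover 1).exp_snd
  · exact exp_neg_two_mul_sub_log_div (one_sub_div_ne_zero hs1 hs) (one_sub_div_ne_zero hx hxy)
      (hover 2).exp_snd

lemma eventually_generic (hx : Reg x₀) (hy : Reg y₀) (hxy : x₀ ≠ y₀) :
    ∀ᶠ s : ℂ × ℂ in 𝓝 (x₀, y₀), Reg s.1 ∧ Reg s.2 ∧ s.1 ≠ s.2 := by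
  have h1 : Tendsto (fun s : ℂ × ℂ => s.1) (𝓝 (x₀, y₀)) (𝓝 x₀) := continuous_fst.tendsto _
  have h2 : Tendsto (fun s : ℂ × ℂ => s.2) (𝓝 (x₀, y₀)) (𝓝 y₀) := continuous_snd.tendsto _
  filter_upwards [h1.eventually_ne hx.1, h1.eventually_ne hx.2, h2.eventually_ne hy.1,
    h2.eventually_ne hy.2, (h1.sub h2).eventually_ne (sub_ne_zero.2 hxy)] with s a b c d e
    using ⟨⟨a, b⟩, ⟨c, d⟩, sub_ne_zero.1 e⟩

lemma eventually_differentiableAt_coords (hx : Reg x₀) (hy : Reg y₀) (hxy : x₀ ≠ y₀) :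
    ∀ᶠ s : ℂ × ℂ in 𝓝 (x₀, y₀),
      DifferentiableAt ℂ (fun s : ℂ × ℂ => Complex.log (s.1 / x₀)) s ∧
      DifferentiableAt ℂ (fun s : ℂ × ℂ => Complex.log ((1 - s.1) / (1 - x₀))) s ∧
      DifferentiableAt ℂ (fun s : ℂ × ℂ => Complex.log (s.2 / y₀)) s ∧
      DifferentiableAt ℂ (fun s : ℂ × ℂ => Complex.log ((1 - s.2) / (1 - y₀))) s ∧
      DifferentiableAt ℂ (fun s : ℂ × ℂ => Complex.log ((1 - s.2 / s.1) / (1 - y₀ / x₀))) s := by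
  have h1 : Tendsto (fun s : ℂ × ℂ => s.1) (𝓝 (x₀, y₀)) (𝓝 x₀) := continuous_fst.tendsto _
  have h2 : Tendsto (fun s : ℂ × ℂ => s.2) (𝓝 (x₀, y₀)) (𝓝 y₀) := continuous_snd.tendsto _
  have key : ∀ {f : ℂ × ℂ → ℂ} {c : ℂ}, c ≠ 0 → Tendsto f (𝓝 (x₀, y₀)) (𝓝 c) →
      ∀ᶠ s in 𝓝 (x₀, y₀), f s / c ∈ slitPlane := by
    intro f c hc hf
    have := hf.div_const c
    rw [div_self hc] at this
    exact this.eventually (isOpen_slitPlane.mem_nhds one_mem_slitPlane)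
  filter_upwards [key hx.1 h1, key (sub_ne_zero.2 hx.2.symm) (h1.const_sub 1), key hy.1 h2,
    key (sub_ne_zero.2 hy.2.symm) (h2.const_sub 1),
    key (one_sub_div_ne_zero hx hxy) ((h2.div h1 hx.1).const_sub 1), h1.eventually_ne hx.1]
    with s k1 k2 k3 k4 k5 k6
  refine ⟨DifferentiableAt.clog (by fun_prop) k1, DifferentiableAt.clog (by fun_prop) k2,
    DifferentiableAt.clog (by fun_prop) k3, DifferentiableAt.clog (by fun_prop) k4,
    DifferentiableAt.clog (by fun_prop (disch := assumption)) k5⟩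

/-- The alternating sum of the forms `½ (b da - a db)` vanishes on the five term linear space. -/
lemma hasFDerivAt_sum_zero {f₀ g₀ f₁ g₁ g₂ : ℂ × ℂ → ℂ} {s : ℂ × ℂ}
    (hf₀ : DifferentiableAt ℂ f₀ s) (hg₀ : DifferentiableAt ℂ g₀ s)
    (hf₁ : DifferentiableAt ℂ f₁ s) (hg₁ : DifferentiableAt ℂ g₁ s)
    (hg₂ : DifferentiableAt ℂ g₂ s) {G : Fin 5 → ℂ × ℂ → ℂ}
    (hG : ∀ i, HasFDerivAt (G i) (rogersForm (ftCoords (f₀ s) (g₀ s) (f₁ s) (g₁ s) (g₂ s) i))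
      (ftCoords (f₀ s) (g₀ s) (f₁ s) (g₁ s) (g₂ s) i)) :
    HasFDerivAt (fun s : ℂ × ℂ => ∑ i : Fin 5, (-1 : ℂ) ^ (i : ℕ) *
      G i (ftCoords (f₀ s) (g₀ s) (f₁ s) (g₁ s) (g₂ s) i)) (0 : ℂ × ℂ →L[ℂ] ℂ) s := by
  have a0 := hf₀.hasFDerivAt
  have b0 := hg₀.hasFDerivAt
  have a1 := hf₁.hasFDerivAt
  have b1 := hg₁.hasFDerivAt
  have b2 := hg₂.hasFDerivAt
  have k0 := HasFDerivAt.comp s (hG 0) (a0.prodMk b0)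
  have k1 := HasFDerivAt.comp s (hG 1) (a1.prodMk b1)
  have k2 := HasFDerivAt.comp s (hG 2) ((a1.sub a0).prodMk b2)
  have k3 := HasFDerivAt.comp s (hG 3) ((((a1.sub a0).add b1).sub b0).prodMk (b2.sub b1))
  have k4 := HasFDerivAt.comp s (hG 4) ((b1.sub b0).prodMk ((b2.sub b1).sub a0))
  have := (((k0.sub k1).add k2).sub k3).add k4
  refine (this.congr_fderiv ?_).congr_of_eventuallyEq (Eventually.of_forall fun s => ?_)
  · refine ContinuousLinearMap.ext fun v => ?_
    simp [rogersForm, ftCoords]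
    ring
  · simp [Fin.sum_univ_five, ftCoords]
    ring

lemma tendsto_ftSection (hx : Reg x₀) (hy : Reg y₀) (hxy : x₀ ≠ y₀)
    (hlin : w₀ = ftCoords (w₀ 0).1 (w₀ 0).2 (w₀ 1).1 (w₀ 1).2 (w₀ 2).2)
    (hover : ∀ i, LiesOver (w₀ i) (ftTuple x₀ y₀ i)) :
    Tendsto (ftSection w₀ x₀ y₀) (𝓝 (x₀, y₀)) (𝓝[FTpre] w₀) := by
  refine tendsto_nhdsWithin_of_tendsto_nhds_of_eventually_within _ ?_ ?_
  · obtain ⟨h1, h2, h3, h4, h5⟩ := (eventually_differentiableAt_coords hx hy hxy).self_of_nhds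
    have g1 := (h1.const_add (w₀ 0).1).continuousAt
    have g2 := (h2.const_sub (w₀ 0).2).continuousAt
    have g3 := (h3.const_add (w₀ 1).1).continuousAt
    have g4 := (h4.const_sub (w₀ 1).2).continuousAt
    have g5 := (h5.const_sub (w₀ 2).2).continuousAt
    have hc : ContinuousAt (ftSection w₀ x₀ y₀) (x₀, y₀) := by
      refine continuousAt_pi.2 fun i => ?_
      fin_cases i
      · exact g1.prodMk g2
      · exact g3.prodMk g4
      · exact (g3.sub g1).prodMk g5
      · exact (((g3.sub g1).add g4).sub g2).prodMk (g5.sub g4)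
      · exact (g4.sub g2).prodMk ((g5.sub g4).sub g1)
    have := hc.tendsto
    rwa [ftSection_self hx hy hxy hlin] at this
  · filter_upwards [eventually_generic hx hy hxy] with s hs
    exact (ftSection_mem_FTlin hx hy hxy hover hs.1 hs.2.1 hs.2.2).1

lemma eventually_fiveTerm_ftSection (hx : Reg x₀) (hy : Reg y₀) (hxy : x₀ ≠ y₀)
    (hlin : w₀ = ftCoords (w₀ 0).1 (w₀ 0).2 (w₀ 1).1 (w₀ 1).2 (w₀ 2).2)
    (hover : ∀ i, LiesOver (w₀ i) (ftTuple x₀ y₀ i)) :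
    ∀ᶠ s in 𝓝 (x₀, y₀), fiveTerm (ftSection w₀ x₀ y₀ s) = fiveTerm w₀ := by
  choose G hG using fun i => exists_primitive (hover i).mem_Cover
  have ht := tendsto_ftSection hx hy hxy hlin hover
  have hG' : ∀ᶠ s in 𝓝 (x₀, y₀), ∀ i,
      rogersMod (ftSection w₀ x₀ y₀ s i) = QuotientAddGroup.mk (G i (ftSection w₀ x₀ y₀ s i)) ∧
      HasFDerivAt (G i) (rogersForm (ftSection w₀ x₀ y₀ s i)) (ftSection w₀ x₀ y₀ s i) :=
    eventually_all.2 fun i => ((tendsto_apply_FTpre w₀ i).comp ht).eventually (hG i)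
  set H : ℂ × ℂ → ℂ := fun s => ∑ i : Fin 5, (-1 : ℂ) ^ (i : ℕ) * G i (ftSection w₀ x₀ y₀ s i)
  have hH : ∀ᶠ s in 𝓝 (x₀, y₀), HasFDerivAt H (0 : ℂ × ℂ →L[ℂ] ℂ) s ∧
      fiveTerm (ftSection w₀ x₀ y₀ s) = QuotientAddGroup.mk (H s) := by
    filter_upwards [hG', eventually_differentiableAt_coords hx hy hxy] with s hs hd
    obtain ⟨h1, h2, h3, h4, h5⟩ := hd
    refine ⟨hasFDerivAt_sum_zero (h1.const_add _) (h2.const_sub _) (h3.const_add _)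
      (h4.const_sub _) (h5.const_sub _) fun i => (hs i).2, ?_⟩
    simp only [fiveTerm, H, (hs _).1, sum_zsmul_mk]
  obtain ⟨ε, hε, hball⟩ := Metric.eventually_nhds_iff_ball.1 hH
  filter_upwards [Metric.ball_mem_nhds _ hε] with s hs
  have hc : H s = H (x₀, y₀) := by
    refine (convex_ball (x₀, y₀) ε).is_const_of_fderivWithin_eq_zero (𝕜 := ℂ)
      (fun t ht => (hball t ht).1.differentiableAt.differentiableWithinAt) (fun t ht => ?_) hs
      (Metric.mem_ball_self hε)
    rw [fderivWithin_of_isOpen Metric.isOpen_ball ht]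
    exact (hball t ht).1.fderiv
  rw [(hball s hs).2, hc, ← (hball _ (Metric.mem_ball_self hε)).2,
    ftSection_self hx hy hxy hlin]

end LocalConstancy

lemma eventually_fiveTerm_eq {w₀ : Fin 5 → ℂ × ℂ} (h₀ : w₀ ∈ FTlin) :
    ∀ᶠ w in 𝓝[FTlin] w₀, fiveTerm w = fiveTerm w₀ := by
  obtain ⟨⟨v, ⟨x₀, y₀, hx, hy, hxy, rfl⟩, hover⟩, hlin⟩ := h₀
  have hle : 𝓝[FTlin] w₀ ≤ 𝓝[FTpre] w₀ := nhdsWithin_mono _ fun w hw => hw.1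
  have ht : ∀ i, Tendsto (fun w : Fin 5 → ℂ × ℂ => w i) (𝓝[FTlin] w₀) (𝓝[Cover] (w₀ i)) :=
    fun i => (tendsto_apply_FTpre w₀ i).mono_left hle
  have hp0 : proj (w₀ 0) = x₀ := (hover 0).proj_eq
  have hp1 : proj (w₀ 1) = y₀ := (hover 1).proj_eq
  have hp2 : proj (w₀ 2) = y₀ / x₀ := (hover 2).proj_eq
  have hp : Tendsto (fun w : Fin 5 → ℂ × ℂ => (proj (w 0), proj (w 1))) (𝓝[FTlin] w₀)
      (𝓝 (x₀, y₀)) := by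
    have hc : Continuous fun w : Fin 5 → ℂ × ℂ => (proj (w 0), proj (w 1)) :=
      (continuous_proj.comp (continuous_apply 0)).prodMk
        (continuous_proj.comp (continuous_apply 1))
    have := (hc.tendsto w₀).mono_left (nhdsWithin_le_nhds (s := FTlin))
    rwa [hp0, hp1] at this
  have e0 := (ht 0).eventually (eventually_fst_eq_of_mem (hover 0).mem_Cover)
  have e1 := (ht 0).eventually (eventually_snd_eq_of_mem (hover 0).mem_Cover)
  have e2 := (ht 1).eventually (eventually_fst_eq_of_mem (hover 1).mem_Cover)
  have e3 := (ht 1).eventually (eventually_snd_eq_of_mem (hover 1).mem_Cover)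
  have e4 := (ht 2).eventually (eventually_snd_eq_of_mem (hover 2).mem_Cover)
  filter_upwards [hp.eventually (eventually_fiveTerm_ftSection hx hy hxy hlin hover), e0, e1, e2,
    e3, e4, self_mem_nhdsWithin] with w hw d0 d1 d2 d3 d4 hmem
  rw [← hw]
  congr 1
  obtain ⟨⟨v, ⟨x, y, -, -, -, rfl⟩, hov⟩, hl⟩ := hmem
  rw [hp0] at d0 d1
  rw [hp1] at d2 d3
  have hq : proj (w 2) = proj (w 1) / proj (w 0) := by
    rw [(hov 2).proj_eq, (hov 1).proj_eq, (hov 0).proj_eq]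
    rfl
  rw [hp2, hq] at d4
  rw [ftSection]
  simp only
  rw [← d0, ← d1, ← d2, ← d3, ← d4]
  exact hl

lemma fiveTerm_eq_of_isPreconnected {S : Set (Fin 5 → ℂ × ℂ)} (hS : IsPreconnected S)
    (hsub : S ⊆ FTlin) {w w' : Fin 5 → ℂ × ℂ} (hw : w ∈ S) (hw' : w' ∈ S) :
    fiveTerm w = fiveTerm w' := by
  refine hS.induction₂ (fun u v => fiveTerm u = fiveTerm v) (fun u hu => ?_)
    (fun _ _ _ _ _ _ h1 h2 => h1.trans h2) (fun _ _ _ _ h1 => h1.symm) hw hw'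
  filter_upwards [nhdsWithin_mono u hsub (eventually_fiveTerm_eq (hsub hu))] with v hv using hv.symm

lemma log_im_mem_of_UHP {z : ℂ} (h : z ∈ UHP) :
    0 < (Complex.log z).im ∧ (Complex.log z).im < Real.pi := by
  have h' : 0 < z.im := h
  rw [Complex.log_im]
  refine ⟨lt_of_le_of_ne (Complex.arg_nonneg_iff.2 h'.le) fun h0 => ?_,
    Complex.arg_lt_pi_iff.2 (Or.inr h'.ne')⟩
  exact h'.ne' (Complex.arg_eq_zero_iff.1 h0.symm).2

lemma log_one_sub_im_mem_of_UHP {z : ℂ} (h : z ∈ UHP) :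
    -Real.pi < (Complex.log (1 - z)).im ∧ (Complex.log (1 - z)).im < 0 := by
  have h' : 0 < z.im := h
  rw [Complex.log_im]
  refine ⟨Complex.neg_pi_lt_arg _, Complex.arg_neg_iff.2 ?_⟩
  simpa using h'

lemma eq_zero_of_exp_eq_one {f : ℂ} (h : exp f = 1) (h1 : -(2 * Real.pi) < f.im)
    (h2 : f.im < 2 * Real.pi) : f = 0 := by
  obtain ⟨n, rfl⟩ := Complex.exp_eq_one_iff.1 h
  have him : ((n : ℂ) * (2 * Real.pi * I)).im = n * (2 * Real.pi) := by simp
  rw [him] at h1 h2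
  have hpi := Real.pi_pos
  have h3 : (-1 : ℝ) < n := by nlinarith
  have h4 : (n : ℝ) < 1 := by nlinarith
  have h5 : -1 < n := by exact_mod_cast h3
  have h6 : n < 1 := by exact_mod_cast h4
  have : n = 0 := by omega
  simp [this]

lemma reg_of_UHP {z : ℂ} (h : z ∈ UHP) : Reg z := by
  have h' : 0 < z.im := h
  constructor
  · rintro rfl
    simp at h'
  · rintro rfl
    simp at h'

/-- The lift of a five term tuple all of whose sheet numbers are zero. -/
def ftLift (x y : ℂ) : Fin 5 → ℂ × ℂ := fun i => pt (ftTuple x y i) 0 0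

lemma ftLift_eq_ftCoords {x y : ℂ} (hxy : x ≠ y) (h : ∀ i, ftTuple x y i ∈ UHP) :
    ftLift x y = ftCoords (Complex.log x) (-Complex.log (1 - x)) (Complex.log y)
      (-Complex.log (1 - y)) (-Complex.log (1 - y / x)) := by
  have h0 : x ∈ UHP := h 0
  have h1 : y ∈ UHP := h 1
  have h2 : y / x ∈ UHP := h 2
  have h3 : (1 - x⁻¹) / (1 - y⁻¹) ∈ UHP := h 3
  have h4 : (1 - x) / (1 - y) ∈ UHP := h 4
  have hx := reg_of_UHP h0
  have hy := reg_of_UHP h1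
  have n0 : 1 - x ≠ 0 := sub_ne_zero.2 hx.2.symm
  have n1 : 1 - y ≠ 0 := sub_ne_zero.2 hy.2.symm
  have n2 := one_sub_div_ne_zero hx hxy
  have r2 := reg_of_UHP h2
  have r3 := reg_of_UHP h3
  have r4 := reg_of_UHP h4
  have n3 := sub_ne_zero.2 r3.2.symm
  have n4 := sub_ne_zero.2 r4.2.symm
  have i0 := log_im_mem_of_UHP h0
  have i1 := log_im_mem_of_UHP h1
  have i2 := log_im_mem_of_UHP h2
  have i3 := log_im_mem_of_UHP h3
  have i4 := log_im_mem_of_UHP h4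
  have j0 := log_one_sub_im_mem_of_UHP h0
  have j1 := log_one_sub_im_mem_of_UHP h1
  have j2 := log_one_sub_im_mem_of_UHP h2
  have j3 := log_one_sub_im_mem_of_UHP h3
  have j4 := log_one_sub_im_mem_of_UHP h4
  have e2 : Complex.log (y / x) - (Complex.log y - Complex.log x) = 0 := by
    refine eq_zero_of_exp_eq_one ?_ ?_ ?_
    · rw [Complex.exp_sub, Complex.exp_sub, Complex.exp_log hx.1, Complex.exp_log hy.1,
        Complex.exp_log r2.1, div_self r2.1]
    · simp only [Complex.sub_im]
      linarith
    · simp only [Complex.sub_im]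
      linarith
  have e4 : Complex.log ((1 - x) / (1 - y)) -
      (Complex.log (1 - x) - Complex.log (1 - y)) = 0 := by
    refine eq_zero_of_exp_eq_one ?_ ?_ ?_
    · rw [Complex.exp_sub, Complex.exp_sub, Complex.exp_log n0, Complex.exp_log n1,
        Complex.exp_log r4.1, div_self r4.1]
    · simp only [Complex.sub_im]
      linarith
    · simp only [Complex.sub_im]
      linarith
  have e3 : Complex.log ((1 - x⁻¹) / (1 - y⁻¹)) -
      (Complex.log (y / x) + Complex.log ((1 - x) / (1 - y))) = 0 := by
    refine eq_zero_of_exp_eq_one ?_ ?_ ?_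
    · rw [Complex.exp_sub, Complex.exp_add, Complex.exp_log r2.1, Complex.exp_log r4.1,
        Complex.exp_log r3.1, ← ftTuple_three hx hy, div_self r3.1]
    · simp only [Complex.sub_im, Complex.add_im]
      linarith
    · simp only [Complex.sub_im, Complex.add_im]
      linarith
  have f3 : Complex.log (1 - (1 - x⁻¹) / (1 - y⁻¹)) -
      (Complex.log (1 - y / x) - Complex.log (1 - y)) = 0 := by
    refine eq_zero_of_exp_eq_one ?_ ?_ ?_
    · rw [Complex.exp_sub, Complex.exp_sub, Complex.exp_log n2, Complex.exp_log n1,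
        Complex.exp_log n3, ← one_sub_ftTuple_three hx hy, div_self n3]
    · simp only [Complex.sub_im] at *
      linarith
    · simp only [Complex.sub_im] at *
      linarith
  have f4 : Complex.log (1 - (1 - x) / (1 - y)) -
      (Complex.log x + Complex.log (1 - (1 - x⁻¹) / (1 - y⁻¹))) = 0 := by
    refine eq_zero_of_exp_eq_one ?_ ?_ ?_
    · rw [Complex.exp_sub, Complex.exp_add, Complex.exp_log hx.1, Complex.exp_log n3,
        Complex.exp_log n4, one_sub_ftTuple_three hx hy, ← mul_div_assoc,
        ← one_sub_ftTuple_four hx hy, div_self n4]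
    · simp only [Complex.sub_im, Complex.add_im] at *
      linarith
    · simp only [Complex.sub_im, Complex.add_im] at *
      linarith
  funext i
  simp only [ftLift, pt, Int.cast_zero, zero_mul, add_zero]
  fin_cases i
  · rfl
  · rfl
  · refine Prod.ext ?_ rfl
    change Complex.log (y / x) = _ - _
    linear_combination e2
  · refine Prod.ext ?_ ?_
    · change Complex.log ((1 - x⁻¹) / (1 - y⁻¹)) = _ - _ + _ - _
      linear_combination e3 + e4 + e2
    · change -Complex.log (1 - (1 - x⁻¹) / (1 - y⁻¹)) = _ - _
      linear_combination -f3
  · refine Prod.ext ?_ ?_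
    · change Complex.log ((1 - x) / (1 - y)) = _ - _
      linear_combination e4
    · change -Complex.log (1 - (1 - x) / (1 - y)) = _ - _ - _
      linear_combination -f4 - f3

lemma ftLift_mem_FTlin {x y : ℂ} (hxy : x ≠ y) (h : ∀ i, ftTuple x y i ∈ UHP) :
    ftLift x y ∈ FTlin := by
  have hx : Reg x := reg_of_UHP (h 0)
  have hy : Reg y := reg_of_UHP (h 1)
  refine ⟨⟨_, ⟨x, y, hx, hy, hxy, rfl⟩, fun i => liesOver_pt (reg_of_UHP (h i)) 0 0⟩, ?_⟩
  rw [ftLift_eq_ftCoords hxy h]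
  rfl

/-- The first coordinate of a path in `FT⁺` from the degenerate five term tuple to the base
point. -/
def pathX (t : ℝ) : ℂ := (t : ℂ) / 4 * (1 + t * I)

/-- The second coordinate of a path in `FT⁺` from the degenerate five term tuple to the base
point. -/
def pathY (t : ℝ) : ℂ := (t : ℂ) ^ 2 * I

lemma pathX_eq (t : ℝ) : pathX t = ((t / 4 : ℝ) : ℂ) + ((t ^ 2 / 4 : ℝ) : ℂ) * I := by
  rw [pathX]
  push_cast
  ring

lemma pathX_im (t : ℝ) : (pathX t).im = t ^ 2 / 4 := by
  rw [pathX_eq, Complex.add_im, Complex.ofReal_im, Complex.im_ofReal_mul, Complex.I_im]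
  ring

lemma pathX_re (t : ℝ) : (pathX t).re = t / 4 := by
  rw [pathX_eq, Complex.add_re, Complex.ofReal_re, Complex.re_ofReal_mul, Complex.I_re]
  ring

lemma pathY_eq (t : ℝ) : pathY t = ((t ^ 2 : ℝ) : ℂ) * I := by
  rw [pathY]
  push_cast
  rfl

lemma pathY_im (t : ℝ) : (pathY t).im = t ^ 2 := by
  rw [pathY_eq, Complex.im_ofReal_mul, Complex.I_im, mul_one]

lemma pathY_re (t : ℝ) : (pathY t).re = 0 := by
  rw [pathY_eq, Complex.re_ofReal_mul, Complex.I_re, mul_zero]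

lemma pathY_div_pathX {t : ℝ} (ht : 0 < t) :
    pathY t / pathX t =
      ((4 * t ^ 2 / (1 + t ^ 2) : ℝ) : ℂ) + ((4 * t / (1 + t ^ 2) : ℝ) : ℂ) * I := by
  have hx : pathX t ≠ 0 := fun h => by
    have := pathX_re t
    rw [h, Complex.zero_re] at this
    linarith
  have hd : (1 + (t : ℂ) ^ 2) ≠ 0 := by
    have : (1 + t ^ 2 : ℝ) ≠ 0 := by positivity
    exact_mod_cast this
  rw [div_eq_iff hx, pathX, pathY]
  push_cast
  field_simp
  linear_combination (-(t : ℂ) ^ 3) * I_sq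

lemma one_sub_pathX_div {t : ℝ} :
    (1 - pathX t) / (1 - pathY t) = (((1 - t / 4 + t ^ 4 / 4) / (1 + t ^ 4) : ℝ) : ℂ) +
      ((t ^ 2 * (3 - t) / 4 / (1 + t ^ 4) : ℝ) : ℂ) * I := by
  have hy : 1 - pathY t ≠ 0 := fun h => by
    have := congrArg Complex.re h
    rw [Complex.sub_re, pathY_re] at this
    norm_num at this
  have hd : (1 + (t : ℂ) ^ 4) ≠ 0 := by
    have : (1 + t ^ 4 : ℝ) ≠ 0 := by positivity
    exact_mod_cast this
  rw [div_eq_iff hy, pathX, pathY]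
  push_cast
  field_simp
  linear_combination ((t : ℂ) ^ 4 * (3 - t)) * I_sq

lemma ftTuple_path_mem_UHP {t : ℝ} (ht : 0 < t) (ht1 : t ≤ 1) (i : Fin 5) :
    ftTuple (pathX t) (pathY t) i ∈ UHP := by
  have h0 : pathX t ∈ UHP := by
    change 0 < (pathX t).im
    rw [pathX_im]
    positivity
  have h1 : pathY t ∈ UHP := by
    change 0 < (pathY t).im
    rw [pathY_im]
    positivity
  have ht3 : 0 < 3 - t := by linarith
  have ht4 : 0 < 1 - t / 4 + t ^ 4 / 4 := by
    have : 0 ≤ t ^ 4 := by positivity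
    linarith
  have e2 := pathY_div_pathX ht
  have e4 := one_sub_pathX_div (t := t)
  fin_cases i
  · exact h0
  · exact h1
  · change 0 < (pathY t / pathX t).im
    rw [e2, Complex.add_im, Complex.ofReal_im, Complex.im_ofReal_mul, Complex.I_im]
    positivity
  · change 0 < ((1 - (pathX t)⁻¹) / (1 - (pathY t)⁻¹)).im
    rw [ftTuple_three (reg_of_UHP h0) (reg_of_UHP h1), e2, e4, Complex.mul_im]
    simp only [Complex.add_im, Complex.ofReal_im, Complex.im_ofReal_mul, Complex.I_im,
      Complex.add_re, Complex.ofReal_re, Complex.re_ofReal_mul, Complex.I_re]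
    simp only [mul_one, mul_zero, zero_add, add_zero]
    positivity
  · change 0 < ((1 - pathX t) / (1 - pathY t)).im
    rw [e4, Complex.add_im, Complex.ofReal_im, Complex.im_ofReal_mul, Complex.I_im]
    positivity

lemma pathX_ne_pathY {t : ℝ} (ht : 0 < t) : pathX t ≠ pathY t := fun h => by
  have := congrArg Complex.re h
  rw [pathX_re, pathY_re] at this
  linarith

lemma continuous_pathX : Continuous pathX := by
  unfold pathX
  fun_prop

lemma continuous_pathY : Continuous pathY := by
  unfold pathY
  fun_prop

lemma pathX_one : pathX 1 = (1 + I) / 4 := by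
  rw [pathX]
  push_cast
  ring

lemma pathY_one : pathY 1 = I := by simp [pathY]

lemma basePt_eq : basePt = ftLift (pathX 1) (pathY 1) := by
  rw [pathX_one, pathY_one]
  rfl

lemma mem_slitPlane_of_UHP {z : ℂ} (h : z ∈ UHP) : z ∈ slitPlane := Or.inr (ne_of_gt h)

lemma one_sub_mem_slitPlane_of_UHP {z : ℂ} (h : z ∈ UHP) : 1 - z ∈ slitPlane := by
  have h' : 0 < z.im := h
  refine Or.inr ?_
  simpa using h'.ne'

lemma isPreconnected_path :
    IsPreconnected ((fun t => ftLift (pathX t) (pathY t)) '' Set.Ioc (0 : ℝ) 1) := by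
  refine isPreconnected_Ioc.image _ ?_
  have hx : ContinuousOn pathX (Set.Ioc 0 1) := continuous_pathX.continuousOn
  have hy : ContinuousOn pathY (Set.Ioc 0 1) := continuous_pathY.continuousOn
  have hq : ContinuousOn (fun t => pathY t / pathX t) (Set.Ioc 0 1) :=
    hy.div hx fun t ht => (reg_of_UHP (ftTuple_path_mem_UHP ht.1 ht.2 0)).1
  have c0 := hx.clog fun t ht => mem_slitPlane_of_UHP (ftTuple_path_mem_UHP ht.1 ht.2 0)
  have c1 := hy.clog fun t ht => mem_slitPlane_of_UHP (ftTuple_path_mem_UHP ht.1 ht.2 1)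
  have d0 := ((continuousOn_const (c := (1 : ℂ))).sub hx).clog fun t ht =>
    one_sub_mem_slitPlane_of_UHP (ftTuple_path_mem_UHP ht.1 ht.2 0)
  have d1 := ((continuousOn_const (c := (1 : ℂ))).sub hy).clog fun t ht =>
    one_sub_mem_slitPlane_of_UHP (ftTuple_path_mem_UHP ht.1 ht.2 1)
  have d2 := ((continuousOn_const (c := (1 : ℂ))).sub hq).clog fun t ht =>
    one_sub_mem_slitPlane_of_UHP (ftTuple_path_mem_UHP ht.1 ht.2 2)
  have hc : ContinuousOn (fun t => ftCoords (Complex.log (pathX t)) (-Complex.log (1 - pathX t))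
      (Complex.log (pathY t)) (-Complex.log (1 - pathY t))
      (-Complex.log (1 - pathY t / pathX t))) (Set.Ioc 0 1) := by
    refine continuousOn_pi.2 fun i => ?_
    fin_cases i
    · exact c0.prodMk d0.neg
    · exact c1.prodMk d1.neg
    · exact (c1.sub c0).prodMk d2.neg
    · exact (((c1.sub c0).add d1.neg).sub d0.neg).prodMk (d2.neg.sub d1.neg)
    · exact (d1.neg.sub d0.neg).prodMk ((d2.neg.sub d1.neg).sub c0)
  exact hc.congr fun t ht =>
    ftLift_eq_ftCoords (pathX_ne_pathY ht.1) fun i => ftTuple_path_mem_UHP ht.1 ht.2 i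

lemma fiveTerm_path {t : ℝ} (ht : 0 < t) (ht1 : t ≤ 1) :
    fiveTerm (ftLift (pathX t) (pathY t)) = fiveTerm basePt := by
  refine fiveTerm_eq_of_isPreconnected isPreconnected_path ?_ ⟨t, ⟨ht, ht1⟩, rfl⟩
    ⟨1, ⟨one_pos, le_rfl⟩, basePt_eq.symm⟩
  rintro _ ⟨s, hs, rfl⟩
  exact ftLift_mem_FTlin (pathX_ne_pathY hs.1) fun i => ftTuple_path_mem_UHP hs.1 hs.2 i

lemma rogers_reflection {z : ℂ} (hz : z ∈ slitPlane) :
    rogers z = Cpi ^ 2 / 6 - rogers (1 - z) := by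
  rw [rogers_eq, rogers_eq, sub_sub_cancel, Cpi]
  linear_combination dilog_reflection hz

lemma tendsto_rogers_path :
    Tendsto (fun t : ℝ => ∑ i : Fin 5, (-1 : ℂ) ^ (i : ℕ) *
      Rfun (ftTuple (pathX t) (pathY t) i) 0 0) (𝓝[>] 0) (𝓝 0) := by
  have hx0 : pathX 0 = 0 := by simp [pathX]
  have hy0 : pathY 0 = 0 := by simp [pathY]
  have hx : Tendsto pathX (𝓝[>] 0) (𝓝 0) := by
    have := (continuous_pathX.tendsto 0).mono_left (nhdsWithin_le_nhds (s := Set.Ioi 0))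
    rwa [hx0] at this
  have hy : Tendsto pathY (𝓝[>] 0) (𝓝 0) := by
    have := (continuous_pathY.tendsto 0).mono_left (nhdsWithin_le_nhds (s := Set.Ioi 0))
    rwa [hy0] at this
  have h4 : Tendsto (fun t => (1 - pathX t) / (1 - pathY t)) (𝓝[>] 0) (𝓝 1) := by
    have : Tendsto (fun t => (1 - pathX t) / (1 - pathY t)) (𝓝[>] 0) (𝓝 ((1 - 0) / (1 - 0))) :=
      (hx.const_sub 1).div (hy.const_sub 1) (by simp)
    simpa using this
  have h4' : Tendsto (fun t => 1 - (1 - pathX t) / (1 - pathY t)) (𝓝[>] 0) (𝓝 0) := by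
    simpa using h4.const_sub 1
  have h2 : Tendsto (fun t => pathY t / pathX t) (𝓝[>] 0) (𝓝 0) := by
    have hc : ContinuousAt (fun t : ℝ => ((4 * t ^ 2 / (1 + t ^ 2) : ℝ) : ℂ) +
        ((4 * t / (1 + t ^ 2) : ℝ) : ℂ) * I) 0 := by
      have : (1 + (0 : ℝ) ^ 2) ≠ 0 := by norm_num
      fun_prop (disch := assumption)
    have := hc.tendsto.mono_left (nhdsWithin_le_nhds (s := Set.Ioi 0))
    refine Tendsto.congr' ?_ (by simpa using this)
    filter_upwards [self_mem_nhdsWithin] with t ht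
    rw [pathY_div_pathX ht]
    push_cast
    rfl
  have hIoc : ∀ᶠ t : ℝ in 𝓝[>] 0, t ∈ Set.Ioc (0 : ℝ) 1 := Ioc_mem_nhdsGT one_pos
  have h3 : Tendsto (fun t => (1 - (pathX t)⁻¹) / (1 - (pathY t)⁻¹)) (𝓝[>] 0) (𝓝 0) := by
    refine Tendsto.congr' ?_ (by simpa using h2.mul h4)
    filter_upwards [hIoc] with t ht
    exact (ftTuple_three (reg_of_UHP (ftTuple_path_mem_UHP ht.1 ht.2 0))
      (reg_of_UHP (ftTuple_path_mem_UHP ht.1 ht.2 1))).symm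
  have key := ((((tendsto_rogers_zero.comp hx).sub (tendsto_rogers_zero.comp hy)).add
    (tendsto_rogers_zero.comp h2)).sub (tendsto_rogers_zero.comp h3)).sub
      (tendsto_rogers_zero.comp h4')
  simp only [sub_zero, add_zero] at key
  refine key.congr' ?_
  filter_upwards [hIoc] with t ht
  have hr : rogers ((1 - pathX t) / (1 - pathY t)) =
      Cpi ^ 2 / 6 - rogers (1 - (1 - pathX t) / (1 - pathY t)) :=
    rogers_reflection (mem_slitPlane_of_UHP (ftTuple_path_mem_UHP ht.1 ht.2 4))
  simp [Fin.sum_univ_five, Rfun, ftTuple] at hr ⊢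
  linear_combination -hr

lemma fiveTerm_basePt : fiveTerm basePt = 0 := by
  obtain ⟨c, hc⟩ := QuotientAddGroup.mk_surjective (fiveTerm basePt)
  have hclosed : IsClosed (AddSubgroup.zmultiples (Cpi ^ 2) : Set ℂ) :=
    AddSubgroup.isClosed_of_discrete
  have hlim := tendsto_rogers_path.const_add (-c)
  rw [add_zero] at hlim
  have hmem := hclosed.mem_of_tendsto hlim (by
    have hIoc : ∀ᶠ t : ℝ in 𝓝[>] 0, t ∈ Set.Ioc (0 : ℝ) 1 := Ioc_mem_nhdsGT one_pos
    filter_upwards [hIoc] with t ht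
    have h := fiveTerm_path ht.1 ht.2
    rw [← hc, fiveTerm] at h
    simp only [ftLift, rogersMod_pt (reg_of_UHP (ftTuple_path_mem_UHP ht.1 ht.2 _)),
      sum_zsmul_mk] at h
    exact QuotientAddGroup.eq.1 h.symm)
  rw [← hc, QuotientAddGroup.eq_zero_iff]
  simpa using hmem

lemma basePt_mem_FTlin : basePt ∈ FTlin := by
  rw [basePt_eq]
  exact ftLift_mem_FTlin (pathX_ne_pathY one_pos) fun i => ftTuple_path_mem_UHP one_pos le_rfl i

lemma basePt_mem_FThat₀ : basePt ∈ FThat₀ := mem_connectedComponentIn basePt_mem_FTlin.1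

lemma isPreconnected_FThat₀ : IsPreconnected FThat₀ := isPreconnected_connectedComponentIn

lemma FThat₀_subset_FTpre : FThat₀ ⊆ FTpre := connectedComponentIn_subset _ _

lemma FThat₀_subset_FTlin : FThat₀ ⊆ FTlin := by
  intro w hw
  refine ⟨FThat₀_subset_FTpre hw, ?_⟩
  have key : ∀ f : (Fin 5 → ℂ × ℂ) → ℂ, Continuous f → f basePt = 0 →
      (∀ v ∈ FThat₀, exp (2 * f v) = 1) → f w = 0 := fun f hf h0 h1 =>
    eq_zero_of_exp_two_mul_of_isPreconnected isPreconnected_FThat₀ hf.continuousOn h1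
      basePt_mem_FThat₀ hw h0
  have hb := basePt_mem_FTlin.2
  have k2 := key (fun v => (v 2).1 - ((v 1).1 - (v 0).1)) (by fun_prop)
    (by rw [hb]; simp [ftCoords]) (fun v hv => by
      obtain ⟨_, ⟨x, y, hx, hy, hxy, rfl⟩, hov⟩ := FThat₀_subset_FTpre hv
      rw [mul_sub, mul_sub, Complex.exp_sub, Complex.exp_sub, (hov 0).exp_fst, (hov 1).exp_fst,
        (hov 2).exp_fst, ← div_pow]
      exact div_self (pow_ne_zero 2 (div_ne_zero hy.1 hx.1)))
  have k3 := key (fun v => (v 3).1 - ((v 1).1 - (v 0).1 + (v 1).2 - (v 0).2)) (by fun_prop)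
    (by rw [hb]; simp [ftCoords]) (fun v hv => by
      obtain ⟨_, ⟨x, y, hx, hy, hxy, rfl⟩, hov⟩ := FThat₀_subset_FTpre hv
      have he : 2 * ((v 3).1 - ((v 1).1 - (v 0).1 + (v 1).2 - (v 0).2)) = 2 * (v 3).1 -
          (2 * (v 1).1 - 2 * (v 0).1 + (-(2 * (v 0).2) - -(2 * (v 1).2))) := by ring
      have h3 : exp (2 * (v 3).1) = ((1 - x⁻¹) / (1 - y⁻¹)) ^ 2 := (hov 3).exp_fst
      have hne : (1 - x⁻¹) / (1 - y⁻¹) ≠ 0 := (reg_ftTuple hx hy hxy 3).1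
      rw [he, Complex.exp_sub, Complex.exp_add, Complex.exp_sub, Complex.exp_sub,
        (hov 0).exp_fst, (hov 1).exp_fst, (hov 0).exp_snd, (hov 1).exp_snd, h3, ← div_pow,
        ← div_pow, ← mul_pow]
      rw [ftTuple_three hx hy] at hne ⊢
      exact div_self (pow_ne_zero 2 hne))
  have l3 := key (fun v => (v 3).2 - ((v 2).2 - (v 1).2)) (by fun_prop)
    (by rw [hb]; simp [ftCoords]) (fun v hv => by
      obtain ⟨_, ⟨x, y, hx, hy, hxy, rfl⟩, hov⟩ := FThat₀_subset_FTpre hv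
      have he : 2 * ((v 3).2 - ((v 2).2 - (v 1).2)) = (-(2 * (v 2).2) - -(2 * (v 1).2)) -
          -(2 * (v 3).2) := by ring
      have h3 : exp (-(2 * (v 3).2)) = (1 - (1 - x⁻¹) / (1 - y⁻¹)) ^ 2 := (hov 3).exp_snd
      have hne : 1 - (1 - x⁻¹) / (1 - y⁻¹) ≠ 0 := sub_ne_zero.2 (reg_ftTuple hx hy hxy 3).2.symm
      rw [he, Complex.exp_sub, Complex.exp_sub, (hov 1).exp_snd, (hov 2).exp_snd, h3, ← div_pow]
      rw [one_sub_ftTuple_three hx hy] at hne ⊢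
      exact div_self (pow_ne_zero 2 hne))
  have k4 := key (fun v => (v 4).1 - ((v 1).2 - (v 0).2)) (by fun_prop)
    (by rw [hb]; simp [ftCoords]) (fun v hv => by
      obtain ⟨_, ⟨x, y, hx, hy, hxy, rfl⟩, hov⟩ := FThat₀_subset_FTpre hv
      have he : 2 * ((v 4).1 - ((v 1).2 - (v 0).2)) = 2 * (v 4).1 -
          (-(2 * (v 0).2) - -(2 * (v 1).2)) := by ring
      have h4 : exp (2 * (v 4).1) = ((1 - x) / (1 - y)) ^ 2 := (hov 4).exp_fst
      have hne : (1 - x) / (1 - y) ≠ 0 := (reg_ftTuple hx hy hxy 4).1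
      rw [he, Complex.exp_sub, Complex.exp_sub, (hov 0).exp_snd, (hov 1).exp_snd, h4, ← div_pow]
      exact div_self (pow_ne_zero 2 hne))
  have l4 := key (fun v => (v 4).2 - ((v 2).2 - (v 1).2 - (v 0).1)) (by fun_prop)
    (by rw [hb]; simp [ftCoords]) (fun v hv => by
      obtain ⟨_, ⟨x, y, hx, hy, hxy, rfl⟩, hov⟩ := FThat₀_subset_FTpre hv
      have he : 2 * ((v 4).2 - ((v 2).2 - (v 1).2 - (v 0).1)) =
          (2 * (v 0).1 + -(2 * (v 2).2) - -(2 * (v 1).2)) - -(2 * (v 4).2) := by ring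
      have h4 : exp (-(2 * (v 4).2)) = (1 - (1 - x) / (1 - y)) ^ 2 := (hov 4).exp_snd
      have hne : 1 - (1 - x) / (1 - y) ≠ 0 := sub_ne_zero.2 (reg_ftTuple hx hy hxy 4).2.symm
      rw [he, Complex.exp_sub, Complex.exp_sub, Complex.exp_add, (hov 0).exp_fst,
        (hov 1).exp_snd, (hov 2).exp_snd, h4, ← mul_pow, ← div_pow]
      rw [one_sub_ftTuple_four hx hy] at hne ⊢
      exact div_self (pow_ne_zero 2 hne))
  funext i
  fin_cases i
  · rfl
  · rfl
  · exact Prod.ext (sub_eq_zero.1 k2) rfl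
  · exact Prod.ext (sub_eq_zero.1 k3) (sub_eq_zero.1 l3)
  · exact Prod.ext (sub_eq_zero.1 k4) (sub_eq_zero.1 l4)

lemma fiveTerm_eq_zero {w : Fin 5 → ℂ × ℂ} (hw : w ∈ FThat₀) : fiveTerm w = 0 := by
  rw [← fiveTerm_basePt]
  exact fiveTerm_eq_of_isPreconnected isPreconnected_FThat₀ FThat₀_subset_FTlin hw
    basePt_mem_FThat₀

lemma reg_ftTuple_base (i : Fin 5) : Reg (ftTuple ((1 + I) / 4) I i) := by
  rw [← pathX_one, ← pathY_one]
  exact reg_of_UHP (ftTuple_path_mem_UHP one_pos le_rfl i)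

lemma even_fst_of_mem_FThat₀ {w : Fin 5 → ℂ × ℂ} (hw : w ∈ FThat₀) {i : Fin 5} {z : ℂ}
    (hz : Reg z) {p q : ℤ} (h : w i = pt z p q) : Even p := by
  have hreg : ∀ {v : Fin 5 → ℂ × ℂ}, v ∈ FThat₀ → LiesOver (v i) (proj (v i)) := fun hv =>
    liesOver_proj (FTpre.mem_Cover (FThat₀_subset_FTpre hv) i)
  have hEq : Set.EqOn (fun v : Fin 5 → ℂ × ℂ => exp (v i).1) (fun v => proj (v i)) FThat₀ := by
    refine isPreconnected_FThat₀.eq_of_sq_eq (by fun_prop)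
      (continuous_proj.comp (continuous_apply i)).continuousOn (fun v hv => ?_)
      (fun hv => (hreg hv).1.1) basePt_mem_FThat₀ ?_
    · simp only [Pi.pow_apply]
      rw [← (hreg hv).exp_fst, sq, ← Complex.exp_add, two_mul]
    · have hb := reg_ftTuple_base i
      simp only [basePt]
      rw [exp_pt_fst hb, (liesOver_pt hb 0 0).proj_eq, zpow_zero, mul_one]
  have h1 : exp (w i).1 = proj (w i) := hEq hw
  rw [h, exp_pt_fst hz, (liesOver_pt hz p q).proj_eq] at h1
  have := even_sub_of_neg_one_zpow_eq (a := p) (b := 0) (mul_left_cancel₀ hz.1 (by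
    rw [h1, zpow_zero, mul_one]))
  rwa [sub_zero] at this

lemma even_snd_of_mem_FThat₀ {w : Fin 5 → ℂ × ℂ} (hw : w ∈ FThat₀) {i : Fin 5} {z : ℂ}
    (hz : Reg z) {p q : ℤ} (h : w i = pt z p q) : Even q := by
  have hreg : ∀ {v : Fin 5 → ℂ × ℂ}, v ∈ FThat₀ → LiesOver (v i) (proj (v i)) := fun hv =>
    liesOver_proj (FTpre.mem_Cover (FThat₀_subset_FTpre hv) i)
  have hEq : Set.EqOn (fun v : Fin 5 → ℂ × ℂ => exp (-(v i).2)) (fun v => 1 - proj (v i))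
      FThat₀ := by
    refine isPreconnected_FThat₀.eq_of_sq_eq (by fun_prop)
      (continuous_const.sub (continuous_proj.comp (continuous_apply i))).continuousOn
      (fun v hv => ?_) (fun hv => sub_ne_zero.2 (hreg hv).1.2.symm) basePt_mem_FThat₀ ?_
    · simp only [Pi.pow_apply]
      rw [← (hreg hv).exp_snd, sq, ← Complex.exp_add, two_mul, neg_add]
    · have hb := reg_ftTuple_base i
      simp only [basePt]
      rw [exp_neg_pt_snd hb, (liesOver_pt hb 0 0).proj_eq, zpow_zero, mul_one]
  have h1 : exp (-(w i).2) = 1 - proj (w i) := hEq hw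
  rw [h, exp_neg_pt_snd hz, (liesOver_pt hz p q).proj_eq] at h1
  have := even_sub_of_neg_one_zpow_eq (a := q) (b := 0)
    (mul_left_cancel₀ (sub_ne_zero.2 hz.2.symm) (by rw [h1, zpow_zero, mul_one]))
  rwa [sub_zero] at this

lemma covAct_pt (m n : ℤ) (z : ℂ) (p q : ℤ) :
    covAct (m, n) (pt z p q) = pt z (p + m) (q + n) := by
  refine Prod.ext ?_ ?_
  · simp only [covAct, pt]
    push_cast
    ring
  · simp only [covAct, pt]
    push_cast
    ring

lemma rogersMod_covAct {z : ℂ} (hz : Reg z) {p q : ℤ} (hp : Even p) (hq : Even q) (v : ℤ × ℤ) :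
    rogersMod (covAct v (pt z p q)) = rogersMod (pt z p q) +
      QuotientAddGroup.mk (Cpi * I / 2 * (v.2 * (pt z p q).1 - v.1 * (pt z p q).2)) := by
  obtain ⟨m, n⟩ := v
  obtain ⟨a, rfl⟩ := hp
  obtain ⟨b, rfl⟩ := hq
  rw [covAct_pt, rogersMod_pt hz, rogersMod_pt hz, ← QuotientAddGroup.mk_add]
  refine mk_eq_mk_of_sub (n * a - m * b) ?_
  simp only [Rfun, pt]
  push_cast
  linear_combination (Cpi ^ 2 * (m * b - n * a)) * I_sq

lemma fiveTerm_covAct {w : Fin 5 → ℂ × ℂ} (hw : w ∈ FThat₀) {v : Fin 5 → ℤ × ℤ}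
    (hv : v ∈ Vset) : fiveTerm (fun i => covAct (v i) (w i)) = 0 := by
  have hlin := (FThat₀_subset_FTlin hw).2
  have hi : ∀ i, rogersMod (covAct (v i) (w i)) = rogersMod (w i) +
      QuotientAddGroup.mk (Cpi * I / 2 * ((v i).2 * (w i).1 - (v i).1 * (w i).2)) := fun i => by
    obtain ⟨z, hz, p, q, h⟩ := FTpre.mem_Cover (FThat₀_subset_FTpre hw) i
    have hp := even_fst_of_mem_FThat₀ hw hz h
    have hq := even_snd_of_mem_FThat₀ hw hz h
    rw [h]
    exact rogersMod_covAct hz hp hq (v i)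
  have h0 : ∑ i : Fin 5, (-1 : ℂ) ^ (i : ℕ) *
      (Cpi * I / 2 * ((v i).2 * (w i).1 - (v i).1 * (w i).2)) = 0 := by
    obtain ⟨p₀, p₁, q₀, q₁, q₂, rfl⟩ := hv
    rw [hlin]
    simp [Fin.sum_univ_five, ftCoords]
    ring
  simp only [fiveTerm, hi, zsmul_add, Finset.sum_add_distrib]
  rw [sum_zsmul_mk, h0, QuotientAddGroup.mk_zero, add_zero]
  exact fiveTerm_eq_zero hw

/-- The extended Rogers dilogarithm `R : 𝓒 → ℂ/π²ℤ`. -/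
def rogersCover (w : CoverT) : ModPiSq := rogersMod w.1

lemma continuous_rogersCover : Continuous rogersCover :=
  continuousOn_iff_continuous_domRestrict.1 continuousOn_rogersMod

lemma rogersCover_pt {z : ℂ} (h : Reg z) (p q : ℤ) :
    rogersCover ⟨pt z p q, pt_mem_Cover h p q⟩ = QuotientAddGroup.mk (Rfun z p q) :=
  rogersMod_pt h p q

lemma lift_rogersCover_genOf {z : ℂ} (h : Reg z) (p q : ℤ) :
    FreeAbelianGroup.lift rogersCover (genOf z h p q) = QuotientAddGroup.mk (Rfun z p q) := by
  rw [genOf, FreeAbelianGroup.lift_apply_of, rogersCover_pt h]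

lemma lift_rogersCover_eq_zero {a : FreeAbelianGroup CoverT}
    (ha : a ∈ FiveTermRels ∪ TransferRels) : FreeAbelianGroup.lift rogersCover a = 0 := by
  rcases ha with ⟨u, ⟨w, hw, v, hv, rfl⟩, hc, rfl⟩ | ⟨z, hz, p, q, p', q', rfl⟩
  · simp only [map_sum, map_zsmul, FreeAbelianGroup.lift_apply_of]
    exact fiveTerm_covAct hw hv
  · simp only [map_sub, map_add, lift_rogersCover_genOf]
    simp only [← QuotientAddGroup.mk_add, ← QuotientAddGroup.mk_sub]
    rw [← QuotientAddGroup.mk_zero]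
    congr 1
    simp only [Rfun]
    ring

/-- The homomorphism `R : êP(ℂ) → ℂ/π²ℤ` induced by the extended Rogers dilogarithm. -/
def rogersHom : EPreBloch →+ ModPiSq :=
  QuotientAddGroup.lift relSub (FreeAbelianGroup.lift rogersCover)
    ((AddSubgroup.closure_le (FreeAbelianGroup.lift rogersCover).ker).2 fun _ ha =>
      lift_rogersCover_eq_zero ha)

end Helpers

/-- `R` gives a well-defined (continuous) map `𝓒 → ℂ/π²ℤ` whose value on the sheet
`(z;p,q)` is the corresponding branch value `R(z;p,q)`, it vanishes modulo `π²ℤ` on every lifted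
five-term relation and every transfer relation, and it induces a homomorphism
`R : êP(ℂ) → ℂ/π²ℤ`. -/
theorem stmt4 :
    ∃ Rbar : CoverT → ModPiSq,
      Continuous Rbar ∧
      (∀ (z : ℂ) (h : Reg z) (p q : ℤ),
        Rbar ⟨pt z p q, pt_mem_Cover h p q⟩ = QuotientAddGroup.mk (Rfun z p q)) ∧
      (∀ a ∈ FiveTermRels ∪ TransferRels, FreeAbelianGroup.lift Rbar a = 0) ∧
      ∃ Rhom : EPreBloch →+ ModPiSq,
        (∀ a : FreeAbelianGroup CoverT,
          Rhom (QuotientAddGroup.mk a) = FreeAbelianGroup.lift Rbar a) ∧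
        ∀ (z : ℂ), Reg z → ∀ (p q : ℤ),
          Rhom (cls z p q) = QuotientAddGroup.mk (Rfun z p q) := by
  refine ⟨rogersCover, continuous_rogersCover, fun z h p q => rogersCover_pt h p q,
    fun a ha => lift_rogersCover_eq_zero ha, rogersHom, fun a => rfl, fun z hz p q => ?_⟩
  rw [cls, dif_pos hz]
  exact lift_rogersCover_genOf hz p q

end ExtendedBloch

end
end

section
/- Let p₀,…,p₄ and q₀,…,q₄ be integers satisfying p₂ = p₁-p₀, p₃ = p₁-p₀+q₁-q₀, q₃ = q₂-q₁, p₄ = q₁-q₀ and q₄ = q₂-q₁-p₀. Then for every tuple (x₀,…,x₄) ∈ FT⁺ one has the exact identity Σᵢ₌₀⁴ (-1)ⁱ R(xᵢ;pᵢ,qᵢ) = 0 in ℂ. -/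
open Complex
open scoped Classical

noncomputable section

namespace ExtendedBloch

/-! ### The dilogarithm integral -/

/-- The integral `∫₀ᶻ log(1-t)/t dt` along the straight segment. -/
def logIntegral (z : ℂ) : ℂ :=
  ∫ s in (0:ℝ)..(1:ℝ), Complex.log (1 - (s : ℂ) * z) / (s : ℂ)

lemma rogers_eq_sub_logIntegral (z : ℂ) :
    rogers z = (1 / 2) * Complex.log z * Complex.log (1 - z) - logIntegral z := rfl

lemma one_sub_ofReal_mul_mem_slitPlane {z : ℂ} (hz : 1 - z ∈ slitPlane) {s : ℝ}
    (hs : s ∈ Set.Icc (0:ℝ) 1) : 1 - (s : ℂ) * z ∈ slitPlane := by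
  have h := StarConvex.add_smul_sub_mem starConvex_one_slitPlane hz hs.1 hs.2
  convert h using 1
  simp [sub_eq_add_neg]

lemma intervalIntegrable_log_one_sub_div {z : ℂ} (hz : 1 - z ∈ slitPlane) :
    IntervalIntegrable (fun s : ℝ ↦ Complex.log (1 - (s : ℂ) * z) / (s : ℂ))
      MeasureTheory.volume 0 1 := by
  set f : ℝ → ℂ := fun s ↦ Complex.log (1 - (s : ℂ) * z) with hf
  have hcont : ContinuousOn f (Set.Icc 0 1) := by
    refine ContinuousOn.clog (by fun_prop) fun s hs ↦ one_sub_ofReal_mul_mem_slitPlane hz hs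
  have hnhds : (fun s : ℝ ↦ 1 - (s : ℂ) * z) ⁻¹' slitPlane ∈ nhds (0:ℝ) :=
    (isOpen_slitPlane.preimage (by fun_prop)).mem_nhds (by simp)
  have hdiff : DifferentiableAt ℝ f 0 := by
    have : HasDerivAt (fun s : ℝ ↦ 1 - (s : ℂ) * z) (-(1 * z)) 0 :=
      ((hasDerivAt_id (0:ℝ)).ofReal_comp.mul_const z).const_sub 1
    exact (this.clog_real (by simp)).differentiableAt
  have hds : ContinuousOn (dslope f 0) (Set.Icc 0 1) := by
    intro s hs
    by_cases h0 : s = 0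
    · subst h0
      exact (continuousAt_dslope_same.2 hdiff).continuousWithinAt
    · exact (continuousWithinAt_dslope_of_ne h0).2 (hcont s hs)
  refine IntervalIntegrable.congr (f := dslope f 0) (fun s hs ↦ ?_)
    (hds.intervalIntegrable_of_Icc zero_le_one)
  rw [Set.uIoc_of_le zero_le_one] at hs
  rw [dslope_of_ne _ hs.1.ne', slope_def_module]
  simp [hf, div_eq_inv_mul]

lemma hasDerivAt_logIntegral {z : ℂ} (hz : 1 - z ∈ slitPlane) (hz0 : z ≠ 0) :
    HasDerivAt logIntegral (Complex.log (1 - z) / z) z := by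
  have hopen : IsOpen {w : ℂ | 1 - w ∈ slitPlane} := isOpen_slitPlane.preimage (by fun_prop)
  obtain ⟨r, hr, hball⟩ := Metric.nhds_basis_closedBall.mem_iff.1 (hopen.mem_nhds hz)
  obtain ⟨C, hC⟩ := ((isCompact_Icc (a := (0:ℝ)) (b := 1)).prod
    (isCompact_closedBall z r)).exists_bound_of_continuousOn
      (f := fun u : ℝ × ℂ ↦ -(1 - (u.1 : ℂ) * u.2)⁻¹)
      ((ContinuousOn.inv₀ (by fun_prop) fun u hu ↦
        slitPlane_ne_zero (one_sub_ofReal_mul_mem_slitPlane (hball hu.2) hu.1)).neg)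
  have key := (intervalIntegral.hasDerivAt_integral_of_dominated_loc_of_deriv_le
    (μ := MeasureTheory.volume) (a := 0) (b := 1) (bound := fun _ ↦ C)
    (F := fun (w : ℂ) (s : ℝ) ↦ Complex.log (1 - (s : ℂ) * w) / (s : ℂ))
    (F' := fun (w : ℂ) (s : ℝ) ↦ -(1 - (s : ℂ) * w)⁻¹) (x₀ := z)
    (Metric.closedBall_mem_nhds z hr)
    (Filter.Eventually.of_forall fun w ↦ by
      have : Measurable fun s : ℝ ↦ Complex.log (1 - (s : ℂ) * w) / (s : ℂ) := by fun_prop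
      exact this.aestronglyMeasurable)
    (intervalIntegrable_log_one_sub_div hz)
    (by
      have : Measurable fun s : ℝ ↦ -(1 - (s : ℂ) * z)⁻¹ := by fun_prop
      exact this.aestronglyMeasurable)
    (Filter.Eventually.of_forall fun s hs w hw ↦ by
      rw [Set.uIoc_of_le zero_le_one] at hs
      exact hC (s, w) ⟨Set.Ioc_subset_Icc_self hs, hw⟩)
    (by simp)
    (Filter.Eventually.of_forall fun s hs w hw ↦ by
      rw [Set.uIoc_of_le zero_le_one] at hs
      have hs0 : (s : ℂ) ≠ 0 := by exact_mod_cast hs.1.ne'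
      have hm := one_sub_ofReal_mul_mem_slitPlane (hball hw) (Set.Ioc_subset_Icc_self hs)
      have hne := slitPlane_ne_zero hm
      have := ((((hasDerivAt_id w).const_mul (s : ℂ)).const_sub 1).clog hm).div_const (s : ℂ)
      refine this.congr_deriv ?_
      simp only [id]
      field_simp)).2
  refine HasDerivAt.congr_deriv (f := logIntegral) key ?_
  have h1 := log_inv_eq_integral hz
  rw [Complex.log_inv _ (slitPlane_arg_ne_pi hz)] at h1
  rw [intervalIntegral.integral_neg, eq_div_iff hz0, neg_mul, mul_comm, neg_eq_iff_eq_neg, h1]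
  rfl

lemma hasDerivAt_rogers {z : ℂ} (hz : z ∈ slitPlane) (hz' : 1 - z ∈ slitPlane) :
    HasDerivAt rogers
      (-(1 / 2) * (Complex.log (1 - z) / z + Complex.log z / (1 - z))) z := by
  have hz0 := slitPlane_ne_zero hz
  have hz1 := slitPlane_ne_zero hz'
  have h := ((((Complex.hasDerivAt_log hz).const_mul (1 / 2)).mul
    (((hasDerivAt_id z).const_sub 1).clog hz')).sub (hasDerivAt_logIntegral hz' hz0))
  refine h.congr_deriv ?_
  simp only [id]
  field_simp
  ring

lemma logIntegral_eq_neg_tsum {z : ℂ} (hz : ‖z‖ < 1) :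
    logIntegral z = -∑' n : ℕ, z ^ (n + 1) / ((n : ℂ) + 1) ^ 2 := by
  have h := intervalIntegral.hasSum_integral_of_dominated_convergence
    (μ := MeasureTheory.volume) (a := 0) (b := 1)
    (F := fun (n : ℕ) (s : ℝ) ↦ -((s : ℂ) ^ n * (z ^ (n + 1) / ((n : ℂ) + 1))))
    (f := fun s : ℝ ↦ Complex.log (1 - (s : ℂ) * z) / (s : ℂ))
    (fun n _ ↦ ‖z‖ ^ n)
    (fun n ↦ Continuous.aestronglyMeasurable (by fun_prop))
    (fun n ↦ Filter.Eventually.of_forall fun s hs ↦ by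
      rw [Set.uIoc_of_le zero_le_one] at hs
      have h1 : ‖(n : ℂ) + 1‖ = (n : ℝ) + 1 := by
        rw [← Nat.cast_succ, Complex.norm_natCast]; push_cast; rfl
      rw [norm_neg, norm_mul, norm_div, norm_pow, norm_pow, h1, Complex.norm_real,
        Real.norm_of_nonneg hs.1.le]
      have h2 : s ^ n ≤ 1 := pow_le_one₀ hs.1.le hs.2
      have h3 : ‖z‖ ^ (n + 1) / ((n : ℝ) + 1) ≤ ‖z‖ ^ n := by
        rw [div_le_iff₀ (by positivity), pow_succ]
        have : (0:ℝ) ≤ n := n.cast_nonneg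
        gcongr
        linarith
      calc s ^ n * (‖z‖ ^ (n + 1) / ((n : ℝ) + 1)) ≤ 1 * ‖z‖ ^ n := by gcongr
        _ = ‖z‖ ^ n := one_mul _)
    (Filter.Eventually.of_forall fun _ _ ↦
      summable_geometric_of_lt_one (norm_nonneg z) hz)
    (by simp)
    (Filter.Eventually.of_forall fun s hs ↦ by
      rw [Set.uIoc_of_le zero_le_one] at hs
      have hs0 : (s : ℂ) ≠ 0 := by exact_mod_cast hs.1.ne'
      have hsz : ‖(s : ℂ) * z‖ < 1 := by
        rw [norm_mul, Complex.norm_real, Real.norm_of_nonneg hs.1.le]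
        nlinarith [norm_nonneg z, hs.1, hs.2]
      have h1 := (hasSum_taylorSeries_neg_log' hsz).neg.div_const (s : ℂ)
      rw [neg_neg] at h1
      refine h1.congr_fun ?_
      intro n
      rw [mul_pow, pow_succ (s : ℂ) n]
      field_simp)
  rw [logIntegral, ← h.tsum_eq, ← tsum_neg]
  refine tsum_congr fun n ↦ ?_
  have h1 : ∫ s in (0:ℝ)..1, (s : ℂ) ^ n = 1 / ((n : ℂ) + 1) := by
    have := intervalIntegral.integral_ofReal (a := 0) (b := 1) (f := fun s : ℝ ↦ s ^ n)
      (μ := MeasureTheory.volume)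
    push_cast at this
    rw [this, integral_pow]
    simp
  rw [intervalIntegral.integral_neg, intervalIntegral.integral_mul_const, h1]
  have : (n : ℂ) + 1 ≠ 0 := Nat.cast_add_one_ne_zero n
  field_simp

lemma tsum_one_div_add_one_sq : ∑' n : ℕ, (1:ℂ) ^ (n + 1) / ((n : ℂ) + 1) ^ 2 = Cpi ^ 2 / 6 := by
  have h := (hasSum_nat_add_iff' 1).2 hasSum_zeta_two
  have h' := (Complex.hasSum_ofReal.2 h).tsum_eq
  simpa [Cpi] using h'

lemma continuousOn_tsum_pow_div_sq :
    ContinuousOn (fun z : ℂ ↦ ∑' n : ℕ, z ^ (n + 1) / ((n : ℂ) + 1) ^ 2)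
      (Metric.closedBall 0 1) := by
  have hs : Summable fun n : ℕ ↦ 1 / ((n : ℝ) + 1) ^ 2 := by
    have := (summable_nat_add_iff 1).2 hasSum_zeta_two.summable
    simpa using this
  refine continuousOn_tsum (fun n ↦ by fun_prop) hs fun n z hz ↦ ?_
  have h1 : ‖(n : ℂ) + 1‖ = (n : ℝ) + 1 := by
    rw [← Nat.cast_succ, Complex.norm_natCast, Nat.cast_succ]
  rw [norm_div, norm_pow, norm_pow, h1]
  gcongr
  exact pow_le_one₀ (norm_nonneg z) (by simpa using hz)

lemma tendsto_logIntegral_one :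
    Filter.Tendsto logIntegral (nhdsWithin 1 (Metric.ball 0 1)) (nhds (-(Cpi ^ 2 / 6))) := by
  have h1 := (continuousOn_tsum_pow_div_sq 1 (by simp)).tendsto.neg
  rw [tsum_one_div_add_one_sq] at h1
  refine (h1.mono_left (nhdsWithin_mono _ Metric.ball_subset_closedBall)).congr' ?_
  filter_upwards [self_mem_nhdsWithin] with z hz
  rw [logIntegral_eq_neg_tsum (by simpa using hz)]

lemma tendsto_log_mul_log_one_sub_zero :
    Filter.Tendsto (fun w : ℂ ↦ Complex.log w * Complex.log (1 - w)) (nhds 0) (nhds 0) := by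
  have hlim : Filter.Tendsto
      (fun w : ℂ ↦ (|‖w‖ * Real.log ‖w‖| + Real.pi * ‖w‖) * (3 / 2)) (nhds 0) (nhds 0) := by
    have hc : Continuous fun w : ℂ ↦ (|‖w‖ * Real.log ‖w‖| + Real.pi * ‖w‖) * (3 / 2) :=
      (((Real.continuous_mul_log.comp continuous_norm).abs).add
        (continuous_const.mul continuous_norm)).mul continuous_const
    simpa using hc.tendsto 0
  refine squeeze_zero_norm' ?_ hlim
  filter_upwards [Metric.closedBall_mem_nhds (0:ℂ) (by norm_num : (0:ℝ) < 1 / 2)] with w hw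
  have h1 : ‖Complex.log (1 - w)‖ ≤ 3 / 2 * ‖w‖ := by
    simpa [sub_eq_add_neg] using norm_log_one_add_half_le_self (z := -w) (by simpa using hw)
  have h2 : ‖Complex.log w‖ ≤ |Real.log ‖w‖| + Real.pi := by
    refine (Complex.norm_le_abs_re_add_abs_im _).trans ?_
    rw [Complex.log_re, Complex.log_im]
    gcongr
    exact Complex.abs_arg_le_pi w
  rw [norm_mul, abs_mul, abs_norm]
  calc ‖Complex.log w‖ * ‖Complex.log (1 - w)‖
      ≤ (|Real.log ‖w‖| + Real.pi) * (3 / 2 * ‖w‖) := by gcongr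
    _ = _ := by ring

lemma tendsto_rogers_zero_s5 : Filter.Tendsto rogers (nhds 0) (nhds 0) := by
  have hcont : ContinuousAt logIntegral 0 := by
    refine ((continuousOn_tsum_pow_div_sq.continuousAt
      (Metric.closedBall_mem_nhds 0 one_pos)).neg).congr ?_
    filter_upwards [Metric.ball_mem_nhds (0:ℂ) one_pos] with z hz
    rw [logIntegral_eq_neg_tsum (by simpa using hz)]
    rfl
  have h := (tendsto_log_mul_log_one_sub_zero.const_mul (1 / 2)).sub hcont.tendsto
  have h0 : logIntegral 0 = 0 := by simp [logIntegral]
  rw [h0, mul_zero, sub_zero] at h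
  refine h.congr fun z ↦ ?_
  rw [rogers_eq_sub_logIntegral, mul_assoc]

lemma tendsto_rogers_one_ball :
    Filter.Tendsto rogers (nhdsWithin 1 (Metric.ball 0 1)) (nhds (Cpi ^ 2 / 6)) := by
  have h1 : Filter.Tendsto (fun z : ℂ ↦ 1 - z) (nhdsWithin 1 (Metric.ball 0 1)) (nhds 0) :=
    ((continuous_const.sub continuous_id).tendsto' (1:ℂ) 0 (by simp)).mono_left nhdsWithin_le_nhds
  have h := ((tendsto_log_mul_log_one_sub_zero.comp h1).const_mul (1 / 2)).sub
    tendsto_logIntegral_one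
  rw [mul_zero, zero_sub, neg_neg] at h
  refine h.congr fun z ↦ ?_
  simp only [Function.comp_apply, sub_sub_cancel, rogers_eq_sub_logIntegral]
  ring

lemma mem_slitPlane_of_mem_UHP {z : ℂ} (hz : z ∈ UHP) : z ∈ slitPlane :=
  Or.inr (ne_of_gt hz)

lemma one_sub_mem_slitPlane_of_mem_UHP {z : ℂ} (hz : z ∈ UHP) : 1 - z ∈ slitPlane :=
  Or.inr (by simpa using ne_of_gt hz)

lemma isOpen_UHP : IsOpen UHP := isOpen_lt continuous_const Complex.continuous_im

/-- Euler's reflection formula for the Rogers dilogarithm. -/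
lemma rogers_add_rogers_one_sub {z : ℂ} (hz : z ∈ UHP) :
    rogers z + rogers (1 - z) = Cpi ^ 2 / 6 := by
  have hderiv : ∀ w ∈ UHP, HasDerivAt (fun w ↦ rogers w + rogers (1 - w)) 0 w := by
    intro w hw
    have h0 := mem_slitPlane_of_mem_UHP hw
    have h1 := one_sub_mem_slitPlane_of_mem_UHP hw
    have h2 := (hasDerivAt_rogers h1 (by simpa using h0)).comp w
      ((hasDerivAt_id w).const_sub 1)
    refine ((hasDerivAt_rogers h0 h1).add h2).congr_deriv ?_
    simp only [sub_sub_cancel]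
    ring
  have hconst : ∀ w ∈ UHP, rogers w + rogers (1 - w) = rogers z + rogers (1 - z) := fun w hw ↦
    isOpen_UHP.is_const_of_deriv_eq_zero (convex_halfSpace_im_gt 0).isPreconnected
      (fun u hu ↦ (hderiv u hu).differentiableAt.differentiableWithinAt)
      (fun u hu ↦ (hderiv u hu).deriv) hw hz
  have hpath : Filter.Tendsto (fun ε : ℝ ↦ 1 - (ε : ℂ) + ε * I) (nhdsWithin 0 (Set.Ioi 0))
      (nhds 1) :=
    (Continuous.tendsto' (by fun_prop) 0 1 (by simp)).mono_left nhdsWithin_le_nhds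
  have hsmall : ∀ᶠ ε : ℝ in nhdsWithin 0 (Set.Ioi 0), ε ∈ Set.Ioo (0:ℝ) 1 :=
    Ioo_mem_nhdsGT one_pos
  have hball : Filter.Tendsto (fun ε : ℝ ↦ 1 - (ε : ℂ) + ε * I) (nhdsWithin 0 (Set.Ioi 0))
      (nhdsWithin 1 (Metric.ball 0 1)) := by
    refine tendsto_nhdsWithin_iff.2 ⟨hpath, ?_⟩
    filter_upwards [hsmall] with ε hε
    rw [mem_ball_zero_iff, ← sq_lt_one_iff₀ (norm_nonneg _), ← Complex.normSq_eq_norm_sq,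
      Complex.normSq_apply]
    simp
    nlinarith [hε.1, hε.2]
  have hzero : Filter.Tendsto (fun ε : ℝ ↦ 1 - (1 - (ε : ℂ) + ε * I)) (nhdsWithin 0 (Set.Ioi 0))
      (nhds 0) := by
    simpa using hpath.const_sub 1
  have hlim := (tendsto_rogers_one_ball.comp hball).add (tendsto_rogers_zero_s5.comp hzero)
  rw [add_zero] at hlim
  refine tendsto_nhds_unique (tendsto_const_nhds.congr' ?_) hlim
  filter_upwards [hsmall] with ε hε
  exact (hconst _ (by simpa [UHP] using hε.1)).symm

lemma tendsto_rogers_one : Filter.Tendsto rogers (nhdsWithin 1 UHP) (nhds (Cpi ^ 2 / 6)) := by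
  have h1 : Filter.Tendsto (fun z : ℂ ↦ 1 - z) (nhdsWithin 1 UHP) (nhds 0) :=
    ((continuous_const.sub continuous_id).tendsto' (1:ℂ) 0 (by simp)).mono_left nhdsWithin_le_nhds
  have h := (tendsto_rogers_zero_s5.comp h1).const_sub (Cpi ^ 2 / 6)
  rw [sub_zero] at h
  refine h.congr' ?_
  filter_upwards [self_mem_nhdsWithin] with z hz
  exact (eq_sub_of_add_eq (rogers_add_rogers_one_sub hz)).symm

/-! ### The five term relation -/

lemma log_div_of_arg_sub_mem {a b : ℂ} (ha : a ≠ 0) (hb : b ≠ 0) (h1 : -Real.pi < a.arg - b.arg)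
    (h2 : a.arg - b.arg ≤ Real.pi) : Complex.log (a / b) = Complex.log a - Complex.log b := by
  rw [← Complex.log_exp (x := Complex.log a - Complex.log b) (by simpa [Complex.log_im] using h1)
    (by simpa [Complex.log_im] using h2), Complex.exp_sub, Complex.exp_log ha, Complex.exp_log hb]

lemma log_div_of_im_pos {a b : ℂ} (ha : 0 < a.im) (hb : 0 < b.im) :
    Complex.log (a / b) = Complex.log a - Complex.log b := by
  have ha0 : 0 ≤ a.arg := Complex.arg_nonneg_iff.2 ha.le
  have hb0 : 0 ≤ b.arg := Complex.arg_nonneg_iff.2 hb.le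
  have ha1 := Complex.arg_le_pi a
  have hb1 : b.arg < Real.pi := Complex.arg_lt_pi_iff.2 (Or.inr hb.ne')
  refine log_div_of_arg_sub_mem ?_ ?_ (by linarith) (by linarith)
  · rintro rfl; simp at ha
  · rintro rfl; simp at hb

lemma log_div_of_im_neg {a b : ℂ} (ha : a.im < 0) (hb : b.im < 0) :
    Complex.log (a / b) = Complex.log a - Complex.log b := by
  have ha0 := Complex.arg_neg_iff.2 ha
  have hb0 := Complex.arg_neg_iff.2 hb
  have ha1 := Complex.neg_pi_lt_arg a
  have hb1 := Complex.neg_pi_lt_arg b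
  refine log_div_of_arg_sub_mem ?_ ?_ (by linarith) (by linarith)
  · rintro rfl; simp at ha
  · rintro rfl; simp at hb

lemma one_sub_inv_div_one_sub_inv {x y : ℂ} (hx : x ≠ 0) (hy : y ≠ 0) (hy1 : 1 - y ≠ 0) :
    (1 - x⁻¹) / (1 - y⁻¹) = (1 - x) * y / (x * (1 - y)) := by
  have hinv : 1 - y⁻¹ = (1 - y) / (-y) := by field_simp; ring
  rw [hinv]
  field_simp
  ring

/-- `ftTuple x y` has all its coordinates in the upper half plane. -/
structure IsPositive (x y : ℂ) : Prop where
  im_fst : 0 < x.im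
  im_snd : 0 < y.im
  im_div : 0 < (y / x).im
  im_cross : 0 < ((1 - x⁻¹) / (1 - y⁻¹)).im
  im_one_sub_div : 0 < ((1 - x) / (1 - y)).im

namespace IsPositive

variable {x y : ℂ}

lemma of_ftTuple (h : ∀ i, ftTuple x y i ∈ UHP) : IsPositive x y :=
  ⟨h 0, h 1, h 2, h 3, h 4⟩

lemma fst_ne_zero (h : IsPositive x y) : x ≠ 0 := slitPlane_ne_zero (Or.inr h.im_fst.ne')

lemma snd_ne_zero (h : IsPositive x y) : y ≠ 0 := slitPlane_ne_zero (Or.inr h.im_snd.ne')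

lemma one_sub_fst_ne_zero (h : IsPositive x y) : 1 - x ≠ 0 :=
  slitPlane_ne_zero (Or.inr (by simpa using h.im_fst.ne'))

lemma one_sub_snd_ne_zero (h : IsPositive x y) : 1 - y ≠ 0 :=
  slitPlane_ne_zero (Or.inr (by simpa using h.im_snd.ne'))

lemma sub_ne_zero (h : IsPositive x y) : x - y ≠ 0 := by
  intro hxy
  have := h.im_div
  rw [_root_.sub_eq_zero.1 hxy, div_self h.snd_ne_zero] at this
  simp at this

lemma one_sub_inv_snd_ne_zero (h : IsPositive x y) : 1 - y⁻¹ ≠ 0 := by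
  have := h.im_cross
  intro h0
  simp [h0] at this

lemma cross_eq (h : IsPositive x y) :
    (1 - x⁻¹) / (1 - y⁻¹) = (1 - x) * y / (x * (1 - y)) :=
  one_sub_inv_div_one_sub_inv h.fst_ne_zero h.snd_ne_zero h.one_sub_snd_ne_zero

lemma one_sub_div_eq (h : IsPositive x y) : 1 - y / x = (x - y) / x := by
  have := h.fst_ne_zero
  field_simp

lemma one_sub_cross_eq (h : IsPositive x y) :
    1 - (1 - x⁻¹) / (1 - y⁻¹) = (x - y) / (x * (1 - y)) := by
  have := h.fst_ne_zero
  have := h.one_sub_snd_ne_zero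
  rw [h.cross_eq]
  field_simp
  ring

lemma one_sub_one_sub_div_eq (h : IsPositive x y) :
    1 - (1 - x) / (1 - y) = (x - y) / (1 - y) := by
  have := h.one_sub_snd_ne_zero
  field_simp
  ring

lemma log_div (h : IsPositive x y) :
    Complex.log (y / x) = Complex.log y - Complex.log x :=
  log_div_of_im_pos h.im_snd h.im_fst

lemma log_one_sub_div (h : IsPositive x y) :
    Complex.log ((1 - x) / (1 - y)) = Complex.log (1 - x) - Complex.log (1 - y) :=
  log_div_of_im_neg (by simpa using h.im_fst) (by simpa using h.im_snd)

lemma log_cross (h : IsPositive x y) :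
    Complex.log ((1 - x⁻¹) / (1 - y⁻¹)) =
      Complex.log y - Complex.log x + (Complex.log (1 - x) - Complex.log (1 - y)) := by
  have key := log_div_of_im_pos h.im_cross h.im_one_sub_div
  have heq : (1 - x⁻¹) / (1 - y⁻¹) / ((1 - x) / (1 - y)) = y / x := by
    have := h.fst_ne_zero
    have := h.one_sub_fst_ne_zero
    have := h.one_sub_snd_ne_zero
    rw [h.cross_eq]
    field_simp
  rw [heq, h.log_div, h.log_one_sub_div] at key
  rw [key, sub_add_cancel]

lemma log_one_sub_cross (h : IsPositive x y) :
    Complex.log (1 - (1 - x⁻¹) / (1 - y⁻¹)) =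
      Complex.log (1 - y / x) - Complex.log (1 - y) := by
  rw [← log_div_of_im_neg (a := 1 - y / x) (b := 1 - y) (by rw [sub_im, one_im]; linarith [h.im_div])
    (by simpa using h.im_snd), h.one_sub_cross_eq, h.one_sub_div_eq, div_div]

lemma log_one_sub_one_sub_div (h : IsPositive x y) :
    Complex.log (1 - (1 - x) / (1 - y)) =
      Complex.log (1 - y / x) - Complex.log (1 - y) + Complex.log x := by
  have key := log_div_of_im_neg (a := 1 - (1 - x) / (1 - y)) (b := 1 - (1 - x⁻¹) / (1 - y⁻¹))
    (by rw [sub_im, one_im]; linarith [h.im_one_sub_div])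
    (by rw [sub_im, one_im]; linarith [h.im_cross])
  have heq : (1 - (1 - x) / (1 - y)) / (1 - (1 - x⁻¹) / (1 - y⁻¹)) = x := by
    have := h.fst_ne_zero
    have := h.sub_ne_zero
    have := h.one_sub_snd_ne_zero
    rw [h.one_sub_cross_eq, h.one_sub_one_sub_div_eq]
    field_simp
  rw [heq, h.log_one_sub_cross] at key
  rw [key, add_sub_cancel]

/-- Positivity is preserved when `x` is moved towards `y` along the segment joining them. -/
lemma lineMap (h : IsPositive x y) {t : ℝ} (ht : t ∈ Set.Ioc (0:ℝ) 1) :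
    IsPositive (y + t * (x - y)) y := by
  obtain ⟨ht0, ht1⟩ := ht
  have hx := h.im_fst
  have hy := h.im_snd
  set w : ℂ := y + t * (x - y) with hw
  have hwre : w.re = y.re + t * (x.re - y.re) := by simp [hw]
  have hwim : w.im = y.im + t * (x.im - y.im) := by simp [hw]
  have hw0 : 0 < w.im := by rw [hwim]; nlinarith
  have him {a b : ℂ} (hb : 0 < normSq b) :
      0 < (a / b).im ↔ 0 < a.im * b.re - a.re * b.im := by
    rw [Complex.div_im, ← sub_div, div_pos_iff_of_pos_right hb]
  have hy1 : 0 < normSq (1 - y) := normSq_pos.2 h.one_sub_snd_ne_zero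
  have hwne : w ≠ 0 := slitPlane_ne_zero (Or.inr hw0.ne')
  refine ⟨hw0, hy, ?_, ?_, ?_⟩
  · have := (him (normSq_pos.2 h.fst_ne_zero)).1 h.im_div
    rw [him (normSq_pos.2 hwne), hwre, hwim]
    nlinarith
  · have h1 := h.im_cross
    rw [h.cross_eq, him (normSq_pos.2 (mul_ne_zero h.fst_ne_zero h.one_sub_snd_ne_zero))] at h1
    rw [one_sub_inv_div_one_sub_inv hwne h.snd_ne_zero h.one_sub_snd_ne_zero,
      him (normSq_pos.2 (mul_ne_zero hwne h.one_sub_snd_ne_zero))]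
    have hQ : 0 ≤ (1 - t) * (((x.re - y.re) ^ 2 + (x.im - y.im) ^ 2) * y.im) := by
      have : 0 ≤ 1 - t := sub_nonneg.2 ht1
      positivity
    refine (mul_pos ht0 (add_pos_of_pos_of_nonneg h1 hQ)).trans_eq ?_
    simp only [mul_re, mul_im, sub_re, sub_im, one_re, one_im, hwre, hwim]
    ring
  · have := (him hy1).1 h.im_one_sub_div
    rw [him hy1]
    simp only [sub_re, sub_im, one_re, one_im, hwre, hwim] at this ⊢
    nlinarith

end IsPositive

/-- The alternating sum of Rogers dilogarithms in the five term relation. -/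
def rogersSum (x y : ℂ) : ℂ :=
  rogers x - rogers y + rogers (y / x) - rogers ((1 - x⁻¹) / (1 - y⁻¹)) +
    rogers ((1 - x) / (1 - y))

lemma IsPositive.hasDerivAt_rogersSum {x y : ℂ} (h : IsPositive x y) :
    HasDerivAt (fun w ↦ rogersSum w y) 0 x := by
  have hx := h.fst_ne_zero
  have hy := h.snd_ne_zero
  have hx1 := h.one_sub_fst_ne_zero
  have hy1 := h.one_sub_snd_ne_zero
  have hxy := h.sub_ne_zero
  have hR {z : ℂ} (hz : 0 < z.im) :=
    hasDerivAt_rogers (mem_slitPlane_of_mem_UHP hz) (one_sub_mem_slitPlane_of_mem_UHP hz)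
  have d0 := hR h.im_fst
  have d2 := (hR h.im_div).comp x ((hasDerivAt_const x y).div (hasDerivAt_id x) hx)
  have d3 := (hR h.im_cross).comp x (((hasDerivAt_inv hx).const_sub 1).div_const (1 - y⁻¹))
  have d4 := (hR h.im_one_sub_div).comp x (((hasDerivAt_id x).const_sub 1).div_const (1 - y))
  refine ((((d0.sub_const (rogers y)).add d2).sub d3).add d4).congr_deriv ?_
  have hinv : 1 - y⁻¹ = (1 - y) / (-y) := by field_simp; ring
  rw [h.log_one_sub_one_sub_div, h.log_one_sub_cross, h.log_cross, h.log_div, h.log_one_sub_div,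
    h.one_sub_one_sub_div_eq, h.one_sub_cross_eq, h.cross_eq, hinv]
  generalize Complex.log (1 - y / x) = e
  rw [h.one_sub_div_eq]
  field_simp
  ring

/-- The five term relation for the Rogers dilogarithm. -/
lemma IsPositive.rogersSum_eq {x y : ℂ} (h : IsPositive x y) : rogersSum x y = Cpi ^ 2 / 6 := by
  set g : ℝ → ℂ := fun t ↦ y + t * (x - y) with hg
  have hderiv : ∀ t ∈ Set.Ioc (0:ℝ) 1, HasDerivAt (fun t ↦ rogersSum (g t) y) 0 t := by
    intro t ht
    have h1 : HasDerivAt (fun s : ℂ ↦ y + s * (x - y)) (1 * (x - y)) (t : ℂ) :=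
      ((hasDerivAt_id (t : ℂ)).mul_const (x - y)).const_add y
    exact ((h.lineMap ht).hasDerivAt_rogersSum.comp (t : ℂ) h1).comp_ofReal.congr_deriv (zero_mul _)
  have hconst : ∀ t ∈ Set.Ioc (0:ℝ) 1, rogersSum (g t) y = rogersSum x y := by
    intro t ht
    have h1 := constant_of_has_deriv_right_zero (f := fun t ↦ rogersSum (g t) y) (a := t) (b := 1)
      (fun s hs ↦ (hderiv s ⟨ht.1.trans_le hs.1, hs.2⟩).continuousAt.continuousWithinAt)
      (fun s hs ↦ (hderiv s ⟨ht.1.trans_le hs.1, hs.2.le⟩).hasDerivWithinAt) 1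
      (Set.right_mem_Icc.2 ht.2)
    simpa [hg] using h1.symm
  have hpos : ∀ᶠ t : ℝ in nhdsWithin 0 (Set.Ioi 0), t ∈ Set.Ioc (0:ℝ) 1 :=
    Ioc_mem_nhdsGT one_pos
  have hgy : Filter.Tendsto g (nhdsWithin 0 (Set.Ioi 0)) (nhds y) :=
    (Continuous.tendsto' (by fun_prop) 0 y (by simp [hg])).mono_left nhdsWithin_le_nhds
  have hy := h.snd_ne_zero
  have t0 : Filter.Tendsto (fun t ↦ rogers (g t)) (nhdsWithin 0 (Set.Ioi 0)) (nhds (rogers y)) :=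
    (hasDerivAt_rogers (mem_slitPlane_of_mem_UHP h.im_snd)
      (one_sub_mem_slitPlane_of_mem_UHP h.im_snd)).continuousAt.tendsto.comp hgy
  have t2 : Filter.Tendsto (fun t ↦ rogers (y / g t)) (nhdsWithin 0 (Set.Ioi 0))
      (nhds (Cpi ^ 2 / 6)) := by
    refine tendsto_rogers_one.comp (tendsto_nhdsWithin_iff.2 ⟨?_, ?_⟩)
    · rw [← div_self hy]
      exact tendsto_const_nhds.div hgy hy
    · filter_upwards [hpos] with t ht using (h.lineMap ht).im_div
  have t3 : Filter.Tendsto (fun t ↦ rogers ((1 - (g t)⁻¹) / (1 - y⁻¹)))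
      (nhdsWithin 0 (Set.Ioi 0)) (nhds (Cpi ^ 2 / 6)) := by
    refine tendsto_rogers_one.comp (tendsto_nhdsWithin_iff.2 ⟨?_, ?_⟩)
    · simpa [div_self h.one_sub_inv_snd_ne_zero] using
        ((hgy.inv₀ hy).const_sub 1).div_const (1 - y⁻¹)
    · filter_upwards [hpos] with t ht using (h.lineMap ht).im_cross
  have t4 : Filter.Tendsto (fun t ↦ rogers ((1 - g t) / (1 - y)))
      (nhdsWithin 0 (Set.Ioi 0)) (nhds (Cpi ^ 2 / 6)) := by
    refine tendsto_rogers_one.comp (tendsto_nhdsWithin_iff.2 ⟨?_, ?_⟩)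
    · simpa [div_self h.one_sub_snd_ne_zero] using (hgy.const_sub 1).div_const (1 - y)
    · filter_upwards [hpos] with t ht using (h.lineMap ht).im_one_sub_div
  have hlim := (((t0.sub_const (rogers y)).add t2).sub t3).add t4
  rw [sub_self, zero_add, sub_self, zero_add] at hlim
  refine tendsto_nhds_unique (tendsto_const_nhds.congr' ?_) hlim
  filter_upwards [hpos] with t ht
  exact (hconst t ht).symm

/-- if the `pᵢ, qᵢ` satisfy the five relations of the lifted five term relation,
then `Σᵢ (-1)ⁱ R(xᵢ;pᵢ,qᵢ) = 0` exactly, for every tuple `(x₀,…,x₄) ∈ FT⁺`. -/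
theorem stmt5 (p q : Fin 5 → ℤ)
    (h2 : p 2 = p 1 - p 0) (h3 : p 3 = p 1 - p 0 + q 1 - q 0) (h3' : q 3 = q 2 - q 1)
    (h4 : p 4 = q 1 - q 0) (h4' : q 4 = q 2 - q 1 - p 0) :
    ∀ v ∈ FTplus, ∑ i : Fin 5, (-1 : ℂ) ^ (i : ℕ) * Rfun (v i) (p i) (q i) = 0 := by
  rintro v ⟨⟨x, y, -, -, -, rfl⟩, hv⟩
  have h := IsPositive.of_ftTuple hv
  have hsum := h.rogersSum_eq
  rw [rogersSum] at hsum
  have e0 : ftTuple x y 0 = x := rfl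
  have e1 : ftTuple x y 1 = y := rfl
  have e2 : ftTuple x y 2 = y / x := rfl
  have e3 : ftTuple x y 3 = (1 - x⁻¹) / (1 - y⁻¹) := rfl
  have e4 : ftTuple x y 4 = (1 - x) / (1 - y) := rfl
  simp only [Fin.sum_univ_five, e0, e1, e2, e3, e4, Rfun, h2, h3, h3', h4, h4']
  rw [h.log_one_sub_one_sub_div, h.log_one_sub_cross, h.log_cross, h.log_div, h.log_one_sub_div]
  push_cast
  simp only [Fin.val_zero, Fin.val_one, Fin.val_two, show ((3 : Fin 5) : ℕ) = 3 from rfl,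
    show ((4 : Fin 5) : ℕ) = 4 from rfl]
  linear_combination hsum

end ExtendedBloch

end
end
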